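/- With P = k[x,y,z,w], Φ a degree-3 Macaulay inverse system, ann Φ containing no nonzero linear form, p bijective, and the symmetric matrix SM equal to zero, the following hold: (1) the minimal number of generators of ann Φ is 9; and (2) ann Φ is the sum of two linked grade-three perfect ideals: there exist ideals I₁ and I₂ of P, with I₁ generated by the six quadratic elements q − x·ℓ_q for q ∈ {y², yz, yw, z², zw, w²}, and elements a₁,a₂,a₃ ∈ I₁ ∩ I₂ forming a regular sequence on P, such that (a₁,a₂,a₃) : I₁ = I₂, (a₁,a₂,a₃) : I₂ = I₁, ann Φ = I₁ + I₂, and each of P/I₁ and P/I₂ admits a free resolution of length three by finitely generated free P-modules. -/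

import Mathlib

open MvPolynomial

noncomputable section

variable (k : Type*) [Field k]

/-- The annihilator ideal `ann Φ = {f : Φ(f·g) = 0 for all g}` of the
linear functional `Φ`. -/
def annIdeal (Φ : MvPolynomial (Fin 4) k →ₗ[k] k) : Ideal (MvPolynomial (Fin 4) k) where
  carrier := {f | ∀ g, Φ (f * g) = 0}
  add_mem' := by
    intro a b ha hb g
    rw [add_mul, map_add, ha g, hb g, add_zero]
  zero_mem' := by intro g; simp
  smul_mem' := by
    intro c a ha g
    have h : c • a * g = a * (c * g) := by rw [smul_eq_mul]; ring
    rw [h]; exact ha (c * g)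

/-- The Macaulay map `p : P₁ → Hom(P₁, k)`, `p(u)(v) = Φ(x·u·v)`. -/
def pMap (Φ : MvPolynomial (Fin 4) k →ₗ[k] k) :
    homogeneousSubmodule (Fin 4) k 1 →ₗ[k]
      (homogeneousSubmodule (Fin 4) k 1 →ₗ[k] k) where
  toFun u :=
    { toFun := fun v => Φ (X 0 * u.1 * v.1)
      map_add' := fun v w => by simp [mul_add]
      map_smul' := fun c v => by simp [mul_smul_comm] }
  map_add' u u' := by
    ext v
    simp [add_mul, mul_add]
  map_smul' c u := by
    ext v
    simp [mul_smul_comm, smul_mul_assoc]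

/-- The symmetric `3 × 3` matrix `SM` of (6.3), built from the Macaulay inverse
system `Φ` and the linear forms `ℓ_q` (`p⁻¹(q·Φ)` for the quadrics `q`);
here `⟨q,q'⟩ = Φ(q·ℓ_{q'})`. -/
def smMatrix (Φ : MvPolynomial (Fin 4) k →ₗ[k] k)
    (ly2 lyz lyw lz2 lzw lw2 : MvPolynomial (Fin 4) k) : Matrix (Fin 3) (Fin 3) k :=
  !![Φ (X 2 ^ 2 * lw2) - Φ (X 2 * X 3 * lzw),
      Φ (X 2 * X 3 * lyw) - Φ (X 2 * X 1 * lw2),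
      Φ (X 1 * X 2 * lzw) - Φ (X 2 ^ 2 * lyw);
    Φ (X 1 * X 3 * lzw) - Φ (X 1 * X 2 * lw2),
      Φ (X 1 ^ 2 * lw2) - Φ (X 1 * X 3 * lyw),
      Φ (X 1 * X 2 * lyw) - Φ (X 1 ^ 2 * lzw);
    Φ (X 1 * X 2 * lzw) - Φ (X 1 * X 3 * lz2),
      Φ (X 1 * X 3 * lyz) - Φ (X 1 ^ 2 * lzw),
      Φ (X 1 ^ 2 * lz2) - Φ (X 1 * X 2 * lyz)]

/-- `R/I` admits a free resolution of length three by finitely generated free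
`R`-modules:  `0 → R^{n₃} → R^{n₂} → R^{n₁} → R` with the image of the last
map equal to `I`. -/
def HasLengthThreeFreeResolution {R : Type*} [CommRing R] (I : Ideal R) : Prop :=
  ∃ (n₁ n₂ n₃ : ℕ)
    (d₃ : (Fin n₃ → R) →ₗ[R] (Fin n₂ → R))
    (d₂ : (Fin n₂ → R) →ₗ[R] (Fin n₁ → R))
    (d₁ : (Fin n₁ → R) →ₗ[R] R),
    Function.Injective d₃ ∧ LinearMap.range d₃ = LinearMap.ker d₂ ∧
      LinearMap.range d₂ = LinearMap.ker d₁ ∧ LinearMap.range d₁ = I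

/-- The least cardinality of a set generating the submodule `p`
(the minimal number of generators of `p`). -/
def Submodule.leastSpanRank {R M : Type*} [Semiring R] [AddCommMonoid M] [Module R M]
    (p : Submodule R M) : Cardinal :=
  ⨅ s : {s : Set M // Submodule.span R s = p}, Cardinal.mk s.1

section AlgPart

universe uK uV

variable {K : Type uK} [Field K]

lemma exists_algebra_of_mul {V : Type uV} [AddCommGroup V] [Module K V] (m : V →ₗ[K] V →ₗ[K] V)
    (o : V) (hcomm : ∀ u v, m u v = m v u) (hone : ∀ u, m o u = u)
    (hassoc : ∀ u v w, m (m u v) w = m u (m v w)) :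
    ∃ (B : Type uV) (_ : CommRing B) (_ : Algebra K B) (e : V ≃ₗ[K] B),
      (∀ u v, e (m u v) = e u * e v) ∧ e o = 1 := by
  let R : CommRing V :=
    { (inferInstance : AddCommGroup V) with
      mul := fun u v => m u v
      one := o
      left_distrib := fun a b c => map_add (m a) b c
      right_distrib := fun a b c => by
        change m (a + b) c = m a c + m b c
        rw [map_add]; rfl
      zero_mul := fun a => by
        change m 0 a = 0
        rw [map_zero]; rfl
      mul_zero := fun a => map_zero (m a)
      mul_assoc := hassoc
      one_mul := hone
      mul_one := fun a => by
        change m a o = a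
        rw [hcomm, hone]
      mul_comm := hcomm }
  let Al : Algebra K V := Algebra.ofModule
    (fun r x y => by
      change m (r • x) y = r • m x y
      rw [map_smul]; rfl)
    (fun r x y => map_smul (m x) r y)
  exact ⟨V, R, Al, LinearEquiv.refl K V, fun u v => rfl, rfl⟩

/-- full symmetry from six relations -/
lemma symm_of_six {S : Type*} (G : Fin 4 → Fin 4 → Fin 4 → Fin 4 → S)
    (T : Fin 4 → Fin 4 → Fin 4 → S)
    (t1 : ∀ i j a, T i j a = T j i a) (t2 : ∀ i j a, T i j a = T i a j)
    (h1 : ∀ i j a b, G i j a b = G j i a b) (h2 : ∀ i j a b, G i j a b = G a b i j)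
    (h0 : ∀ j a b, G 0 j a b = T j a b)
    (e1 : G 2 2 3 3 = G 2 3 2 3) (e2 : G 2 3 1 3 = G 1 2 3 3) (e3 : G 1 2 2 3 = G 2 2 1 3)
    (e4 : G 1 1 3 3 = G 1 3 1 3) (e5 : G 1 2 1 3 = G 1 1 2 3) (e6 : G 1 1 2 2 = G 1 2 1 2)
    (i j a b : Fin 4) : G i j a b = G a j i b := by
  have h3 : ∀ i j a b, G i j a b = G i j b a := fun i j a b => by
    rw [h2, h1, h2]
  have case : ∀ x : Fin 4, x = 0 ∨ x = 1 ∨ x = 2 ∨ x = 3 := by decide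
  by_cases hi : i = 0
  · rw [hi, h0, h2 a j, h0, t1 b, t2 a, t1 a]
  by_cases ha : a = 0
  · rw [ha, h0, h2 i j, h0, t1 b, t2 i, t1 i]
  by_cases hj : j = 0
  · rw [hj, h1, h0, h1 a, h0, t1]
  by_cases hb : b = 0
  · rw [hb, h2, h1, h0, h2, h1, h0, t1]
  have a1 := fun x y => h1 2 1 x y
  have a2 := fun x y => h1 3 1 x y
  have a3 := fun x y => h1 3 2 x y
  have b1 := fun x y => h3 x y 2 1
  have b2 := fun x y => h3 x y 3 1
  have b3 := fun x y => h3 x y 3 2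
  have c1 := h2 1 2 1 1
  have c2 := h2 1 3 1 1
  have c3 := h2 2 2 1 1
  have c4 := h2 2 3 1 1
  have c5 := h2 3 3 1 1
  have d2 := h2 1 3 1 2
  have d3 := h2 2 2 1 2
  have d4 := h2 2 3 1 2
  have d5 := h2 3 3 1 2
  have f3 := h2 2 2 1 3
  have f4 := h2 2 3 1 3
  have f5 := h2 3 3 1 3
  have g4 := h2 2 3 2 2
  have g5 := h2 3 3 2 2
  have g6 := h2 3 3 2 3
  rw [f3] at e3
  rw [f4] at e2
  clear h1 h2 h3 h0 t1 t2
  rcases (case i).resolve_left hi with rfl | rfl | rfl <;>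
  rcases (case j).resolve_left hj with rfl | rfl | rfl <;>
  rcases (case a).resolve_left ha with rfl | rfl | rfl <;>
  rcases (case b).resolve_left hb with rfl | rfl | rfl <;>
  simp only [a1, a2, a3, b1, b2, b3, c1, c2, c3, c4, c5, d2, d3, d4, d5, f3, f4, f5, g4, g5, g6, e1,
    e2, e3, e4, e5, e6]

/-- the structure map to `B[t]`. -/
def piMap {B : Type*} [CommRing B] [Algebra K B] (c : Fin 4 → B) :
    MvPolynomial (Fin 4) K →ₐ[K] Polynomial B :=
  aeval (fun i => Polynomial.C (c i) * Polynomial.X)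

abbrev P1 (K : Type*) [Field K] := homogeneousSubmodule (Fin 4) K 1

def X1 (i : Fin 4) : P1 K := ⟨X i, isHomogeneous_X K i⟩

lemma P1_span : (⊤ : Submodule K (P1 K)) = Submodule.span K (Set.range X1) := by
  symm
  rw [eq_top_iff]
  rintro ⟨u, hu⟩ -
  have hu' : u ∈ homogeneousSubmodule (Fin 4) K 1 := hu
  rw [homogeneousSubmodule_one_eq_span_X] at hu'
  have : Submodule.map (P1 K).subtype (Submodule.span K (Set.range X1)) =
      Submodule.span K (Set.range X) := by
    rw [Submodule.map_span, ← Set.range_comp]; rfl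
  rw [← this] at hu'
  obtain ⟨w, hw, hwu⟩ := hu'
  have : w = ⟨u, hu⟩ := Subtype.ext hwu
  rwa [← this]

lemma P1_induction {p : P1 K → Prop} (base : ∀ i, p (X1 i)) (add : ∀ u v, p u → p v → p (u + v))
    (smul : ∀ (a : K) u, p u → p (a • u)) (u : P1 K) : p u := by
  have hu : u ∈ Submodule.span K (Set.range X1) := by rw [← P1_span]; trivial
  induction hu using Submodule.span_induction with
  | mem x h => obtain ⟨i, rfl⟩ := h; exact base i
  | zero => simpa using smul 0 _ (base 0)
  | add x y _ _ hx hy => exact add x y hx hy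
  | smul a x _ hx => exact smul a x hx

lemma X1_li : LinearIndependent K (X1 : Fin 4 → P1 K) := by
  apply LinearIndependent.of_comp (P1 K).subtype
  exact MvPolynomial.linearIndependent_X _ _

def basisP1 : Module.Basis (Fin 4) K (P1 K) := Module.Basis.mk X1_li (le_of_eq P1_span)

lemma basisP1_apply (i : Fin 4) : basisP1 (K := K) i = X1 i := by simp [basisP1]

/-- trilinear form -/
def triForm (Φ : MvPolynomial (Fin 4) K →ₗ[K] K) :
    P1 K →ₗ[K] P1 K →ₗ[K] (P1 K →ₗ[K] K) :=
  LinearMap.mk₂ K (fun u v => (Φ ∘ₗ LinearMap.mulLeft K (u.1 * v.1)) ∘ₗ (P1 K).subtype)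
    (fun a b c => by ext t; simp [add_mul, mul_assoc])
    (fun a b c => by ext t; simp [mul_assoc])
    (fun a b c => by ext t; simp [mul_add, add_mul, mul_assoc])
    (fun a b c => by ext t; simp [mul_assoc])

lemma triForm_apply (Φ : MvPolynomial (Fin 4) K →ₗ[K] K) (u v t : P1 K) :
    triForm Φ u v t = Φ (u.1 * v.1 * t.1) := by simp [triForm, mul_assoc]

lemma pMap_apply' (Φ : MvPolynomial (Fin 4) K →ₗ[K] K) (u v : P1 K) :
    pMap K Φ u v = Φ (X 0 * u.1 * v.1) := rfl

section
variable (Φ : MvPolynomial (Fin 4) K →ₗ[K] K) (hp : Function.Bijective (pMap K Φ))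

def mulP : P1 K →ₗ[K] P1 K →ₗ[K] P1 K :=
  (triForm Φ).compr₂ (LinearEquiv.ofBijective (pMap K Φ) hp).symm.toLinearMap

lemma mulP_spec (u v t : P1 K) : Φ (X 0 * (mulP Φ hp u v).1 * t.1) = Φ (u.1 * v.1 * t.1) := by
  rw [← pMap_apply', ← triForm_apply]
  have : pMap K Φ (mulP Φ hp u v) = triForm Φ u v :=
    (LinearEquiv.ofBijective (pMap K Φ) hp).apply_symm_apply _
  rw [this]

include hp in
lemma P1_ext {u v : P1 K} (h : ∀ t : P1 K, Φ (X 0 * u.1 * t.1) = Φ (X 0 * v.1 * t.1)) : u = v := by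
  apply hp.1
  ext1 t
  exact h t

lemma mulP_comm (u v : P1 K) : mulP Φ hp u v = mulP Φ hp v u := by
  apply P1_ext Φ hp
  intro t
  rw [mulP_spec, mulP_spec, mul_comm u.1]

lemma mulP_one (u : P1 K) : mulP Φ hp (X1 0) u = u := by
  apply P1_ext Φ hp
  intro t
  rw [mulP_spec]; rfl

/-- quadrilinear form -/
def quadForm : P1 K →ₗ[K] P1 K →ₗ[K] P1 K →ₗ[K] P1 K →ₗ[K] K :=
  LinearMap.mk₂ K (fun u v => (mulP Φ hp).compr₂ (pMap K Φ (mulP Φ hp u v)))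
    (fun a b c => by ext t s; simp)
    (fun a b c => by ext t s; simp)
    (fun a b c => by ext t s; simp)
    (fun a b c => by ext t s; simp)

lemma quadForm_apply (u v t s : P1 K) :
    quadForm Φ hp u v t s = Φ (X 0 * (mulP Φ hp u v).1 * (mulP Φ hp t s).1) := rfl

lemma quadForm_apply' (u v t s : P1 K) :
    quadForm Φ hp u v t s = Φ (u.1 * v.1 * (mulP Φ hp t s).1) := by
  rw [quadForm_apply, mulP_spec]

lemma mulP_assoc_of (h : ∀ i j a b, quadForm Φ hp (X1 i) (X1 j) (X1 a) (X1 b) =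
      quadForm Φ hp (X1 a) (X1 j) (X1 i) (X1 b)) (u v t : P1 K) :
    mulP Φ hp (mulP Φ hp u v) t = mulP Φ hp u (mulP Φ hp v t) := by
  have hsym : ∀ u v t s, quadForm Φ hp u v t s = quadForm Φ hp t v u s := by
    intro u v t s
    induction u using P1_induction with
    | add a b ha hb => simp only [map_add, LinearMap.add_apply, ha, hb]
    | smul a b ha => simp only [map_smul, LinearMap.smul_apply, ha]
    | base i =>
    induction v using P1_induction with
    | add a b ha hb => simp only [map_add, LinearMap.add_apply, ha, hb]
    | smul a b ha => simp only [map_smul, LinearMap.smul_apply, ha]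
    | base j =>
    induction t using P1_induction with
    | add a b ha hb => simp only [map_add, LinearMap.add_apply, ha, hb]
    | smul a b ha => simp only [map_smul, LinearMap.smul_apply, ha]
    | base l =>
    induction s using P1_induction with
    | add a b ha hb => simp only [map_add, ha, hb]
    | smul a b ha => simp only [map_smul, ha]
    | base r => exact h _ _ _ _
  apply P1_ext Φ hp
  intro s
  rw [mulP_spec, mulP_spec]
  have e1 : (mulP Φ hp u v).1 * t.1 * s.1 = t.1 * s.1 * (mulP Φ hp u v).1 := by ring
  have e2 : u.1 * (mulP Φ hp v t).1 * s.1 = u.1 * s.1 * (mulP Φ hp v t).1 := by ring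
  rw [e1, e2, ← quadForm_apply', ← quadForm_apply']
  rw [hsym t s u v]
  rw [quadForm_apply, quadForm_apply, mulP_comm Φ hp t v]

/-- main output of part A -/
theorem exists_frobenius (hΦ : ∀ m : Fin 4 →₀ ℕ, (m.sum fun _ e => e) ≠ 3 → Φ (monomial m 1) = 0)
    (hq : ∀ i j a b, quadForm Φ hp (X1 i) (X1 j) (X1 a) (X1 b) =
      quadForm Φ hp (X1 a) (X1 j) (X1 i) (X1 b)) :
    ∃ (B : Type uK) (_ : CommRing B) (_ : Algebra K B) (c : Module.Basis (Fin 4) K B)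
      (φ : B →ₗ[K] K), c 0 = 1 ∧ (∀ a, (∀ b, φ (a * b) = 0) → a = 0) ∧
      (∀ f, Φ f = φ ((piMap (K := K) c f).coeff 3)) ∧
      (∀ (l : MvPolynomial (Fin 4) K) (i j : Fin 4), l ∈ P1 K →
        (∀ v ∈ P1 K, Φ (X 0 * l * v) = Φ (X i * X j * v)) →
        piMap (K := K) c l = Polynomial.C (c i * c j) * Polynomial.X) := by
  obtain ⟨B, iB, aB, e, hmul, hone⟩ := exists_algebra_of_mul (mulP Φ hp) (X1 0) (mulP_comm Φ hp)
    (mulP_one Φ hp) (mulP_assoc_of Φ hp hq)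
  have hc : ∀ i, (basisP1.map e) i = e (X1 i) := fun i => by
    rw [Module.Basis.map_apply, basisP1_apply]
  let φ : B →ₗ[K] K := (pMap K Φ (X1 0)) ∘ₗ e.symm.toLinearMap
  have hφ : ∀ u v t : P1 K, φ (e u * e v * e t) = Φ (u.1 * v.1 * t.1) := by
    intro u v t
    rw [← hmul, ← hmul]
    change pMap K Φ (X1 0) (e.symm (e _)) = _
    rw [e.symm_apply_apply, pMap_apply']
    rw [mul_assoc, mul_comm (X1 0).1, ← mul_assoc, mulP_spec, ← mulP_spec Φ hp u v]
    congr 1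
    change _ = X 0 * _ * _
    change _ * _ * X 0 = _
    ring
  have hφ2 : ∀ u v : P1 K, φ (e u * e v) = Φ (X 0 * u.1 * v.1) := by
    intro u v
    have := hφ (X1 0) u v
    rwa [hone, one_mul] at this
  refine ⟨B, iB, aB, basisP1.map e, φ, ?_, ?_, ?_, ?_⟩
  · rw [hc, hone]
  · intro a ha
    obtain ⟨u, rfl⟩ := e.surjective a
    have : u = 0 := by
      apply P1_ext Φ hp
      intro t
      rw [← hφ2, ha]; simp
    rw [this, map_zero]
  · intro f
    have : Φ = φ ∘ₗ (Polynomial.lcoeff B 3).restrictScalars K ∘ₗ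
        (piMap (K := K) (basisP1.map e)).toLinearMap := by
      ext m
      change Φ (monomial m 1) = φ ((piMap (K := K) (basisP1.map e) (monomial m 1)).coeff 3)
      have hmon : ∀ s : Multiset (Fin 4), monomial (Multiset.toFinsupp s) (1 : K) =
          (s.map X).prod := by
        intro s
        induction s using Multiset.induction_on with
        | empty => simp
        | cons a s ih =>
          rw [Multiset.map_cons, Multiset.prod_cons, ← ih, ← Multiset.singleton_add, map_add,
            Multiset.toFinsupp_singleton, X, monomial_mul, one_mul]
      have hm : m = Multiset.toFinsupp (Finsupp.toMultiset m) := by simp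
      have hpi : ∀ s : Multiset (Fin 4), piMap (K := K) (basisP1.map e) (s.map X).prod =
          Polynomial.C ((s.map (basisP1.map e)).prod) * Polynomial.X ^ (Multiset.card s) := by
        intro s
        induction s using Multiset.induction_on with
        | empty => simp
        | cons a s ih =>
          rw [Multiset.map_cons, Multiset.prod_cons, Multiset.map_cons, Multiset.prod_cons,
            map_mul, ih, Multiset.card_cons, piMap, aeval_X, map_mul]
          ring
      by_cases hd : (m.sum fun _ e => e) = 3
      · have h3 : Multiset.card (Finsupp.toMultiset m) = 3 := by
          rw [Finsupp.card_toMultiset]; exact hd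
        rw [hm, hmon, hpi, h3]
        obtain ⟨x, y, z, h⟩ := Multiset.card_eq_three.1 h3
        rw [h]
        simp only [Polynomial.coeff_C_mul, Polynomial.coeff_X_pow, if_true, mul_one]
        have := hφ (X1 x) (X1 y) (X1 z)
        simp only [Multiset.insert_eq_cons, Multiset.map_cons, Multiset.map_singleton,
          Multiset.prod_cons, Multiset.prod_singleton, hc, ← mul_assoc]
        rw [this]; rfl
      · rw [hΦ m hd, hm, hmon, hpi]
        have h3 : Multiset.card (Finsupp.toMultiset m) ≠ 3 := by
          rw [Finsupp.card_toMultiset]; exact hd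
        rw [Polynomial.coeff_C_mul, Polynomial.coeff_X_pow, if_neg (Ne.symm h3), mul_zero, map_zero]
    rw [this]; rfl
  · intro l i j hl h
    have hpi : ∀ u : P1 K, piMap (K := K) (basisP1.map e) u.1 =
        Polynomial.C (e u) * Polynomial.X := by
      intro u
      induction u using P1_induction with
      | base i => rw [← hc]; simp [piMap, X1]
      | add a b ha hb =>
        rw [Submodule.coe_add, map_add, ha, hb, map_add, map_add, add_mul]
      | smul a u hu =>
        rw [Submodule.coe_smul, map_smul, hu, map_smul, ← Polynomial.smul_C, ← smul_mul_assoc]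
    have h2 : (⟨l, hl⟩ : P1 K) = mulP Φ hp (X1 i) (X1 j) := by
      apply P1_ext Φ hp
      intro t
      rw [mulP_spec]
      exact h t.1 t.2
    have := hpi ⟨l, hl⟩
    rw [h2, hmul] at this
    rw [hc, hc, ← this, ← h2]

end

end AlgPart

section AlgPart2
universe uK
variable {K : Type uK} [Field K]
variable (Φ : MvPolynomial (Fin 4) K →ₗ[K] K) (hp : Function.Bijective (pMap K Φ))

lemma quad_eq (l : MvPolynomial (Fin 4) K) (a b : Fin 4) (hl : l ∈ P1 K)
    (h : ∀ v ∈ P1 K, Φ (X 0 * l * v) = Φ (X a * X b * v)) (i j : Fin 4) :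
    quadForm Φ hp (X1 i) (X1 j) (X1 a) (X1 b) = Φ (X i * X j * l) := by
  have h2 : (⟨l, hl⟩ : P1 K) = mulP Φ hp (X1 a) (X1 b) := by
    apply P1_ext Φ hp
    intro t
    rw [mulP_spec]
    exact h t.1 t.2
  rw [quadForm_apply', ← h2]; rfl

lemma quad_symm
    (ly2 lyz lyw lz2 lzw lw2 : MvPolynomial (Fin 4) K)
    (hly2m : ly2 ∈ P1 K) (hlyzm : lyz ∈ P1 K) (hlywm : lyw ∈ P1 K)
    (hlz2m : lz2 ∈ P1 K) (hlzwm : lzw ∈ P1 K) (hlw2m : lw2 ∈ P1 K)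
    (hly2 : ∀ v ∈ P1 K, Φ (X 0 * ly2 * v) = Φ (X 1 * X 1 * v))
    (hlyz : ∀ v ∈ P1 K, Φ (X 0 * lyz * v) = Φ (X 1 * X 2 * v))
    (hlyw : ∀ v ∈ P1 K, Φ (X 0 * lyw * v) = Φ (X 1 * X 3 * v))
    (hlz2 : ∀ v ∈ P1 K, Φ (X 0 * lz2 * v) = Φ (X 2 * X 2 * v))
    (hlzw : ∀ v ∈ P1 K, Φ (X 0 * lzw * v) = Φ (X 2 * X 3 * v))
    (hlw2 : ∀ v ∈ P1 K, Φ (X 0 * lw2 * v) = Φ (X 3 * X 3 * v))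
    (hSM : smMatrix K Φ ly2 lyz lyw lz2 lzw lw2 = 0) (i j a b : Fin 4) :
    quadForm Φ hp (X1 i) (X1 j) (X1 a) (X1 b) =
      quadForm Φ hp (X1 a) (X1 j) (X1 i) (X1 b) := by
  have s00 := congrFun (congrFun hSM 0) 0
  have s01 := congrFun (congrFun hSM 0) 1
  have s02 := congrFun (congrFun hSM 0) 2
  have s11 := congrFun (congrFun hSM 1) 1
  have s12 := congrFun (congrFun hSM 1) 2
  have s22 := congrFun (congrFun hSM 2) 2
  simp only [smMatrix, Matrix.of_apply, Matrix.cons_val', Matrix.cons_val_zero, Matrix.cons_val_one,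
    Matrix.cons_val, Matrix.zero_apply, sub_eq_zero, pow_two] at s00 s01 s02 s11 s12 s22
  rw [mul_comm (X 2) (X 1)] at s01
  have sw : ∀ i j a b, quadForm Φ hp (X1 i) (X1 j) (X1 a) (X1 b) =
      quadForm Φ hp (X1 a) (X1 b) (X1 i) (X1 j) := fun i j a b => by
    rw [quadForm_apply, quadForm_apply]; congr 1; ring
  refine symm_of_six (fun i j a b => quadForm Φ hp (X1 i) (X1 j) (X1 a) (X1 b))
    (fun i j a => Φ (X i * X j * X a)) ?_ ?_ ?_ sw ?_ ?_ ?_ ?_ ?_ ?_ ?_ i j a b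
  · intro i j a; simp only [mul_comm (X i)]
  · intro i j a; simp only [mul_assoc, mul_comm (X j)]
  · intro i j a b; simp only [quadForm_apply, mulP_comm Φ hp (X1 i)]
  · intro j a b
    rw [quadForm_apply, mulP_one, mul_assoc, mul_comm (X1 j).1, ← mul_assoc, mulP_spec]
    change Φ (X a * X b * X j) = _
    congr 1; ring
  · rw [quad_eq Φ hp lw2 3 3 hlw2m hlw2, quad_eq Φ hp lzw 2 3 hlzwm hlzw, s00]
  · rw [quad_eq Φ hp lw2 3 3 hlw2m hlw2, quad_eq Φ hp lyw 1 3 hlywm hlyw, s01]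
  · rw [quad_eq Φ hp lzw 2 3 hlzwm hlzw, quad_eq Φ hp lyw 1 3 hlywm hlyw, s02]
  · rw [quad_eq Φ hp lw2 3 3 hlw2m hlw2, quad_eq Φ hp lyw 1 3 hlywm hlyw, s11]
  · rw [quad_eq Φ hp lzw 2 3 hlzwm hlzw, quad_eq Φ hp lyw 1 3 hlywm hlyw, s12]
  · rw [quad_eq Φ hp lz2 2 2 hlz2m hlz2, quad_eq Φ hp lyz 1 2 hlyzm hlyz, s22]

end AlgPart2

section UnitPart
variable {K : Type*} [Field K]

lemma unit_pi {ι : Type*} [Fintype ι] (F : ι → Type*) [∀ i, CommRing (F i)] [∀ i, Algebra K (F i)]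
    (hF : ∀ i, ∀ a : F i, a ≠ 0 → IsUnit a) [∀ i, Nontrivial (F i)] [∀ i, Module.Finite K (F i)]
    (hd : Module.finrank K (∀ i, F i) = 4) (φ : (∀ i, F i) →ₗ[K] K)
    (hnd : ∀ a, (∀ b, φ (a * b) = 0) → a = 0) : ∃ v, IsUnit v ∧ φ v = 0 := by
  classical
  let ψ : ∀ i, F i →ₗ[K] K := fun i => φ ∘ₗ LinearMap.single K F i
  have hψ : ∀ v, φ v = ∑ i, ψ i (v i) := by
    intro v
    conv_lhs => rw [← Finset.univ_sum_single v]
    rw [map_sum]; rfl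
  have hne : ∀ i, ψ i ≠ 0 := by
    intro i h
    have h1 : (Pi.single i (1 : F i) : ∀ i, F i) = 0 := by
      apply hnd
      intro b
      have : (Pi.single i (1 : F i) : ∀ i, F i) * b = Pi.single i (b i) := by
        rw [← Pi.single_mul_left, one_mul]
      rw [this]
      exact congrArg (fun f => f (b i)) h
    have := congrFun h1 i
    simp at this
  have hsurj : ∀ i, Function.Surjective (ψ i) := fun i => LinearMap.surjective (hne i)
  by_cases hc : ∀ i, Function.Injective (ψ i)
  · have h1 : ∀ i, Module.finrank K (F i) = 1 := fun i => by
      rw [(LinearEquiv.ofBijective (ψ i) ⟨hc i, hsurj i⟩).finrank_eq, Module.finrank_self]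
    have hι : Fintype.card ι = 4 := by
      have := Module.finrank_pi_fintype K (M := F)
      rw [hd] at this
      simp [h1] at this
      omega
    let ee := Fintype.equivFinOfCardEq hι
    let s : Fin 4 → K := ![1, -1, 1, -1]
    have hs : ∀ i, s i ≠ 0 := by
      intro i; fin_cases i <;> simp [s]
    choose a ha using fun i => hsurj i (s (ee i))
    refine ⟨a, ?_, ?_⟩
    · rw [Pi.isUnit_iff]
      intro i
      apply hF
      intro h
      have := ha i
      rw [h, map_zero] at this
      exact hs _ this.symm
    · rw [hψ]
      simp only [ha]
      rw [ee.sum_comp s]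
      simp [s, Fin.sum_univ_four]
  · push Not at hc
    obtain ⟨i, hi⟩ := hc
    obtain ⟨a, ha, ha0⟩ : ∃ a, ψ i a = 0 ∧ a ≠ 0 := by
      by_contra h
      push Not at h
      exact hi ((injective_iff_map_eq_zero _).2 h)
    obtain ⟨b, hb, hb0⟩ : ∃ b, ψ i b = - ∑ j ∈ Finset.univ.erase i, ψ j 1 ∧ b ≠ 0 := by
      by_cases hr : - ∑ j ∈ Finset.univ.erase i, ψ j 1 = 0
      · exact ⟨a, by rw [hr, ha], ha0⟩
      · obtain ⟨b, hb⟩ := hsurj i (- ∑ j ∈ Finset.univ.erase i, ψ j 1)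
        refine ⟨b, hb, ?_⟩
        rintro rfl
        rw [map_zero] at hb
        exact hr hb.symm
    refine ⟨Function.update 1 i b, ?_, ?_⟩
    · rw [Pi.isUnit_iff]
      intro j
      by_cases h : j = i
      · subst h; simpa using hF _ b hb0
      · simp [Function.update_of_ne h]
    · rw [hψ, ← Finset.add_sum_erase _ _ (Finset.mem_univ i), Function.update_self, hb]
      rw [neg_add_eq_zero]
      apply Finset.sum_congr rfl
      intro j hj
      rw [Function.update_of_ne (Finset.ne_of_mem_erase hj)]; rfl

theorem exists_unit_ker {B : Type*} [CommRing B] [Algebra K B] (c : Module.Basis (Fin 4) K B)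
    (φ : B →ₗ[K] K) (hnd : ∀ a, (∀ b, φ (a * b) = 0) → a = 0) : ∃ v, IsUnit v ∧ φ v = 0 := by
  have hfin : Module.Finite K B := Module.Finite.of_basis c
  have hart : IsArtinianRing B := IsArtinianRing.of_finite K B
  have hdim : Module.finrank K B = 4 := by rw [Module.finrank_eq_card_basis c]; simp
  by_cases hred : IsReduced B
  · let e : B ≃+* _ := (IsArtinianRing.equivPi B).toRingEquiv
    letI : Fintype (MaximalSpectrum B) := Fintype.ofFinite _
    let e' : B ≃ₗ[K] (∀ I : MaximalSpectrum B, B ⧸ I.asIdeal) :=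
      { e with
        map_smul' := fun r x => by
          ext I
          rfl }
    have hmul : ∀ x y, e' (x * y) = e' x * e' y := fun x y => map_mul e x y
    have hmul' : ∀ x y, e'.symm (x * y) = e'.symm x * e'.symm y := fun x y => by
      apply e'.injective
      rw [hmul]; simp
    obtain ⟨v, hv, hv0⟩ := unit_pi (K := K) (fun I : MaximalSpectrum B => B ⧸ I.asIdeal)
      (fun I a ha => by
        letI := Ideal.Quotient.field I.asIdeal
        exact isUnit_iff_ne_zero.2 ha)
      (by rw [← e'.finrank_eq, hdim]) (φ ∘ₗ e'.symm.toLinearMap) (by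
        intro a ha
        have : e'.symm a = 0 := by
          apply hnd
          intro b
          have := ha (e' b)
          simpa [hmul'] using this
        simpa using this)
    refine ⟨e'.symm v, ?_, hv0⟩
    exact hv.map e.symm
  · rw [isReduced_iff] at hred
    push Not at hred
    obtain ⟨s, hs, hs0⟩ := hred
    obtain ⟨b, hb⟩ : ∃ b, φ (s * b) ≠ 0 := by
      by_contra h
      push Not at h
      exact hs0 (hnd s h)
    refine ⟨1 + (-(φ 1) / φ (s * b)) • (s * b), ?_, ?_⟩
    · apply IsNilpotent.isUnit_one_add
      rw [Algebra.smul_def]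
      exact (Commute.all _ _).isNilpotent_mul_left ((Commute.all _ _).isNilpotent_mul_right hs)
    · rw [map_add, map_smul, smul_eq_mul, div_mul_cancel₀ _ hb, add_neg_cancel]

end UnitPart

section EtaPart
variable {K : Type*} [Field K] {B : Type*} [CommRing B] [Algebra K B]

lemma radical_ker {φ : B →ₗ[K] K} (hnd : ∀ a, (∀ b, φ (a * b) = 0) → a = 0) (hφ : φ ≠ 0) (u : B)
    (hu : ∀ b, φ b = 0 → φ (u * b) = 0) : ∃ l : K, l • (1 : B) = u := by
  obtain ⟨w, hw⟩ := LinearMap.surjective hφ 1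
  refine ⟨φ (u * w), ?_⟩
  symm
  rw [← sub_eq_zero]
  apply hnd
  intro b
  have h := hu (b - φ b • w) (by rw [map_sub, map_smul, hw]; simp)
  rw [mul_sub, map_sub, mul_smul_comm, map_smul, smul_eq_mul, sub_eq_zero] at h
  rw [sub_mul, map_sub, smul_mul_assoc, one_mul, map_smul, h, smul_eq_mul]; ring

theorem exists_eta_zeta (c : Module.Basis (Fin 4) K B)
    (φ : B →ₗ[K] K) (hnd : ∀ a, (∀ b, φ (a * b) = 0) → a = 0) (h1 : φ 1 = 0) :
    ∃ (η ζ : B) (b : Module.Basis (Fin 4) K B) (α γ a0 a1 a2 b0 b1 b2 : K),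
      (⇑b = ![1, η, ζ, η * ζ]) ∧ φ η = 0 ∧ φ ζ = 0 ∧ φ (η * ζ) ≠ 0 ∧
      η * η = α • (η * ζ) + (a0 • 1 + a1 • η + a2 • ζ) ∧
      ζ * ζ = γ • (η * ζ) + (b0 • 1 + b1 • η + b2 • ζ) ∧ 1 - α * γ ≠ 0 := by
  have hfin : Module.Finite K B := Module.Finite.of_basis c
  have hdim : Module.finrank K B = 4 := by rw [Module.finrank_eq_card_basis c]; simp
  have hnt : Nontrivial B := Module.nontrivial_of_finrank_pos (R := K) (by omega)
  have hφ : φ ≠ 0 := by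
    rintro rfl
    exact one_ne_zero (hnd 1 (by simp))
  have hker : Module.finrank K (LinearMap.ker φ) = 3 := by
    have h2 := LinearMap.finrank_range_add_finrank_ker φ
    rw [LinearMap.range_eq_top.2 (LinearMap.surjective hφ), finrank_top, Module.finrank_self] at h2
    omega
  have hex : ∀ x y : B, ∃ z, φ z = 0 ∧ ∀ a b : K, a • x + b • y ≠ z := by
    intro x y
    classical
    have : ¬ LinearMap.ker φ ≤ Submodule.span K {x, y} := by
      intro h
      have h2 := Submodule.finrank_mono h
      have h3 := finrank_span_finset_le_card (R := K) ({x, y} : Finset B)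
      have h4 := Finset.card_le_two (a := x) (b := y)
      rw [Set.finrank, Finset.coe_pair] at h3
      omega
    obtain ⟨z, hz, hz2⟩ := SetLike.not_le_iff_exists.1 this
    rw [Submodule.mem_span_pair] at hz2
    push Not at hz2
    exact ⟨z, hz, hz2⟩
  obtain ⟨η, hη, hη1⟩ := hex 1 0
  have hη1 : ∀ a : K, a • 1 ≠ η := fun a => by simpa using hη1 a 0
  obtain ⟨ζ1, hζ1, hζη⟩ : ∃ z, φ z = 0 ∧ φ (η * z) ≠ 0 := by
    by_contra h
    push Not at h
    obtain ⟨l, hl⟩ := radical_ker hnd hφ η h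
    exact hη1 l hl
  obtain ⟨κ, hκ, hκ1⟩ := hex 1 η
  obtain ⟨ζ, hζ, hω, hζ1'⟩ : ∃ ζ, φ ζ = 0 ∧ φ (η * ζ) ≠ 0 ∧ ∀ a b : K, a • 1 + b • η ≠ ζ := by
    by_cases hs : ∀ a b : K, a • 1 + b • η ≠ ζ1
    · exact ⟨ζ1, hζ1, hζη, hs⟩
    · push Not at hs
      obtain ⟨a, b, hab⟩ := hs
      by_cases hk : φ (η * κ) = 0
      · refine ⟨ζ1 + κ, by rw [map_add, hζ1, hκ, add_zero], ?_, ?_⟩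
        · rw [mul_add, map_add, hk, add_zero]; exact hζη
        · intro a' b' h
          apply hκ1 (a' - a) (b' - b)
          have e : (a' - a) • (1 : B) + (b' - b) • η = (a' • 1 + b' • η) - (a • 1 + b • η) := by module
          rw [e, h, hab]; abel
      · exact ⟨κ, hκ, hk, hκ1⟩
  have hli : LinearIndependent K ![1, η, ζ, η * ζ] := by
    rw [Fintype.linearIndependent_iff]
    intro g hg
    simp only [Fin.sum_univ_four, Matrix.cons_val_zero, Matrix.cons_val_one, Matrix.cons_val] at hg
    have g3 : g 3 = 0 := by
      have := congrArg φ hg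
      simp only [map_add, map_smul, h1, hη, hζ, smul_zero, zero_add, map_zero, smul_eq_mul, mul_zero] at this
      exact (mul_eq_zero.1 this).resolve_right hω
    rw [g3, zero_smul, add_zero] at hg
    have g2 : g 2 = 0 := by
      by_contra h
      apply hζ1' (-(g 2)⁻¹ * g 0) (-(g 2)⁻¹ * g 1)
      have h5 : ζ = (g 2)⁻¹ • (g 2 • ζ) := by rw [smul_smul, inv_mul_cancel₀ h, one_smul]
      have h6 : g 2 • ζ = - (g 0 • 1 + g 1 • η) := by
        rw [eq_neg_iff_add_eq_zero, add_comm]; exact hg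
      rw [h5, h6]; module
    rw [g2, zero_smul, add_zero] at hg
    have g1 : g 1 = 0 := by
      by_contra h
      apply hη1 (-(g 1)⁻¹ * g 0)
      have h5 : η = (g 1)⁻¹ • (g 1 • η) := by rw [smul_smul, inv_mul_cancel₀ h, one_smul]
      have h6 : g 1 • η = - (g 0 • 1) := by
        rw [eq_neg_iff_add_eq_zero, add_comm]; exact hg
      conv_rhs => rw [h5, h6]
      module
    rw [g1, zero_smul, add_zero] at hg
    have g0 : g 0 = 0 := by simpa using hg
    intro i; fin_cases i <;> assumption
  let b := basisOfLinearIndependentOfCardEqFinrank hli (by rw [hdim]; simp)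
  have hb : ⇑b = ![1, η, ζ, η * ζ] := coe_basisOfLinearIndependentOfCardEqFinrank _ _
  have hrep : ∀ x : B, x = b.repr x 3 • (η * ζ) + (b.repr x 0 • 1 + b.repr x 1 • η + b.repr x 2 • ζ) := by
    intro x
    conv_lhs => rw [← b.sum_repr x]
    simp only [hb, Fin.sum_univ_four, Matrix.cons_val_zero, Matrix.cons_val_one, Matrix.cons_val]
    abel
  have hφrep : ∀ x : B, φ x = b.repr x 3 * φ (η * ζ) := by
    intro x
    conv_lhs => rw [hrep x]
    simp only [map_add, map_smul, h1, hη, hζ, smul_eq_mul, mul_zero, add_zero]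
  refine ⟨η, ζ, b, _, _, _, _, _, _, _, _, hb, hη, hζ, hω, hrep _, hrep _, ?_⟩
  intro h0
  set α := b.repr (η * η) 3
  set γ := b.repr (ζ * ζ) 3
  obtain ⟨l, hl⟩ := radical_ker hnd hφ (η - α • ζ) (by
    intro x hx
    have hx3 : b.repr x 3 = 0 := by
      rw [hφrep] at hx
      exact (mul_eq_zero.1 hx).resolve_right hω
    rw [hrep x, hx3, zero_smul, zero_add]
    have e : (η - α • ζ) * (b.repr x 0 • 1 + b.repr x 1 • η + b.repr x 2 • ζ) =
      b.repr x 0 • η - (b.repr x 0 * α) • ζ + b.repr x 1 • (η * η) - (b.repr x 1 * α) • (η * ζ)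
        + b.repr x 2 • (η * ζ) - (b.repr x 2 * α) • (ζ * ζ) := by
      simp only [Algebra.smul_def, map_mul]; ring
    rw [e]
    simp only [map_add, map_sub, map_smul, hη, hζ, smul_zero, smul_eq_mul, hφrep (η * η),
      hφrep (ζ * ζ)]
    linear_combination (b.repr x 2) * φ (η * ζ) * h0)
  rw [Fintype.linearIndependent_iff] at hli
  have := hli ![-l, 1, -α, 0] (by
    simp only [Fin.sum_univ_four, Matrix.cons_val_zero, Matrix.cons_val_one, Matrix.cons_val,
      neg_smul, hl]
    module) 1
  simp at this

end EtaPart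

section CorePart
open scoped Polynomial

variable {K : Type*} [Field K] {B : Type*} [CommRing B] [Algebra K B] {A : Type*} [CommRing A]

/-- membership condition describing the subring `E`. -/
def InE (φ : B →ₗ[K] K) (q : B[X]) : Prop :=
  (∃ c : K, q.coeff 0 = algebraMap K B c) ∧ φ (q.coeff 1) = 0

def wT (ω : B) : B[X] := Polynomial.C ω * Polynomial.X

def rPol (ω v : B) : B[X][X] :=
  Polynomial.C (Polynomial.C v * Polynomial.X ^ 2) +
    (Polynomial.X + Polynomial.C (wT ω)) * (Polynomial.X ^ 2 - Polynomial.C (wT ω ^ 2))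

def aPol (ω v : B) : B[X][X] := (Polynomial.X - Polynomial.C (wT ω)) * rPol ω v

lemma wT_coeff_zero (ω : B) : (wT ω).coeff 0 = 0 := by simp [wT]

lemma rPol_natDegree [Nontrivial B] (ω v : B) :
    (rPol ω v).natDegree = 3 ∧ (rPol ω v).Monic := by
  have h1 : (Polynomial.X + Polynomial.C (wT ω)).Monic := Polynomial.monic_X_add_C _
  have h2 : (Polynomial.X ^ 2 - Polynomial.C (wT ω ^ 2)).Monic :=
    Polynomial.monic_X_pow_sub_C _ (by norm_num)
  have h3 := h1.mul h2
  have h4 : ((Polynomial.X + Polynomial.C (wT ω)) *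
      (Polynomial.X ^ 2 - Polynomial.C (wT ω ^ 2))).natDegree = 3 := by
    rw [h1.natDegree_mul h2, Polynomial.natDegree_X_add_C, Polynomial.natDegree_X_pow_sub_C]
  unfold rPol
  have h5 : (Polynomial.C (Polynomial.C v * Polynomial.X ^ 2) : B[X][X]).degree <
      ((Polynomial.X + Polynomial.C (wT ω)) *
      (Polynomial.X ^ 2 - Polynomial.C (wT ω ^ 2))).degree := by
    rw [Polynomial.degree_eq_natDegree h3.ne_zero, h4]
    exact lt_of_le_of_lt Polynomial.degree_C_le (by norm_num)
  refine ⟨?_, h3.add_of_right h5⟩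
  rw [Polynomial.natDegree_add_eq_right_of_degree_lt h5, h4]

lemma aPol_eq (ω v : B) : aPol ω v =
    Polynomial.X ^ 4 + Polynomial.C (-2 * wT ω ^ 2) * Polynomial.X ^ 2 +
      Polynomial.C (Polynomial.C v * Polynomial.X ^ 2) * Polynomial.X +
      Polynomial.C (wT ω ^ 4 - wT ω * (Polynomial.C v * Polynomial.X ^ 2)) := by
  unfold aPol rPol
  simp only [map_mul, map_sub, map_pow, map_neg, map_ofNat]
  ring

lemma X_sub_eval {q : B[X][X]} {w : B[X]} (h : q.eval w = 0) :
    ∃ s, q = (Polynomial.X - Polynomial.C w) * s := by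
  obtain ⟨s, hs⟩ := Polynomial.dvd_iff_isRoot.mpr h
  exact ⟨s, hs⟩

lemma CX_cancel {p q : B[X][X]} (h : Polynomial.C Polynomial.X * p = Polynomial.C Polynomial.X * q) :
    p = q := by
  ext1 i
  have := congrArg (fun r => Polynomial.coeff r i) h
  simp only [Polynomial.coeff_C_mul] at this
  exact Polynomial.monic_X.isRegular.left this

lemma inE_of_low {φ : B →ₗ[K] K} {q : B[X]} (h0 : q.coeff 0 = 0) (h1 : q.coeff 1 = 0) :
    InE φ q := ⟨⟨0, by simp [h0]⟩, by simp [h1]⟩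

lemma inE_sq_mul {φ : B →ₗ[K] K} {q : B[X]} : InE φ (Polynomial.X ^ 2 * q) :=
  inE_of_low (by simp [Polynomial.coeff_X_pow_mul']) (by simp [Polynomial.coeff_X_pow_mul'])

lemma exists_lift {ε : A →+* B[X]} {φ : B →ₗ[K] K}
    (hE : ∀ q, InE φ q ↔ ∃ a, ε a = q) {p : B[X][X]} (hp : ∀ i, InE φ (p.coeff i)) :
    ∃ f : A[X], f.map ε = p := by
  rw [← Polynomial.mem_lifts, Polynomial.lifts_iff_coeff_lifts]
  intro n
  exact (hE _).1 (hp n)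

lemma mul_inE {φ : B →ₗ[K] K} {c q : B[X]} (h0 : c.coeff 0 = 0) (h1 : φ (c.coeff 1) = 0)
    (hq : ∃ l : K, q.coeff 0 = algebraMap K B l) : InE φ (c * q) := by
  obtain ⟨l, hl⟩ := hq
  refine ⟨⟨0, by simp [Polynomial.mul_coeff_zero, h0]⟩, ?_⟩
  rw [Polynomial.mul_coeff_one, h0, hl, zero_mul, zero_add, mul_comm, ← Algebra.smul_def, map_smul,
    h1, smul_zero]

lemma inE_C_mul {φ : B →ₗ[K] K} (h1 : φ 1 = 0) {n : ℕ} {l : K} :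
    InE φ ((Polynomial.X : B[X]) ^ n * Polynomial.C (algebraMap K B l)) := by
  have h1' : ∀ l, φ (algebraMap K B l) = 0 := fun l => by
    rw [Algebra.algebraMap_eq_smul_one, map_smul, h1, smul_zero]
  refine ⟨⟨if n = 0 then l else 0, ?_⟩, ?_⟩
  · rcases n with _ | n <;> simp
  · rcases n with _ | _ | n
    · simp [Polynomial.coeff_C]
    · simp [h1']
    · simp [Polynomial.coeff_X_pow_mul']

lemma aPol_lift (ε : A →+* B[X]) (φ : B →ₗ[K] K) (ω v : B)
    (hE : ∀ q, InE φ q ↔ ∃ a, ε a = q) : aPol ω v ∈ Polynomial.lifts ε := by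
  have hC : ∀ q : B[X], Polynomial.C (Polynomial.X ^ 2 * q) ∈ Polynomial.lifts ε := by
    intro q
    obtain ⟨a, ha⟩ := (hE (Polynomial.X ^ 2 * q)).1 inE_sq_mul
    rw [← ha]; exact Polynomial.C_mem_lifts ε a
  have e1 : (wT ω ^ 2) = Polynomial.X ^ 2 * Polynomial.C (ω ^ 2) := by
    rw [wT, mul_pow, map_pow, mul_comm]
  have e2 : (-2 * wT ω ^ 2) = Polynomial.X ^ 2 * (-2 * Polynomial.C (ω ^ 2)) := by
    rw [e1]; ring
  have e3 : wT ω ^ 4 - wT ω * (Polynomial.C v * Polynomial.X ^ 2) = Polynomial.X ^ 2 *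
      (Polynomial.X ^ 2 * Polynomial.C (ω ^ 2) ^ 2 - wT ω * Polynomial.C v) := by
    rw [show wT ω ^ 4 = (wT ω ^ 2) ^ 2 by ring, e1]; ring
  rw [aPol_eq, e2, e3, mul_comm (Polynomial.C v)]
  exact add_mem (add_mem (add_mem (Polynomial.X_pow_mem_lifts ε 4)
    (mul_mem (hC _) (Polynomial.X_pow_mem_lifts ε 2)))
    (mul_mem (hC _) (Polynomial.X_mem_lifts ε))) (hC _)

lemma q3_lift (ε : A →+* B[X]) (φ : B →ₗ[K] K) (ω : B) (hφ1 : φ 1 = 0)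
    (hE : ∀ q, InE φ q ↔ ∃ a, ε a = q) : ∃ f : A[X], f.map ε =
      (Polynomial.C Polynomial.X * (Polynomial.X - Polynomial.C (wT ω)) : B[X][X]) := by
  obtain ⟨a, ha⟩ := (hE (Polynomial.X ^ 2 * Polynomial.C ω)).1 inE_sq_mul
  obtain ⟨b, hb⟩ := (hE (Polynomial.X ^ 1 * Polynomial.C (algebraMap K B 1))).1 (inE_C_mul hφ1)
  refine ⟨Polynomial.C b * Polynomial.X - Polynomial.C a, ?_⟩
  rw [Polynomial.map_sub, Polynomial.map_mul, Polynomial.map_C, Polynomial.map_C, ha, hb,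
    Polynomial.map_X, wT]
  simp only [map_mul, map_pow, map_one]
  ring

lemma q4_lift (ε : A →+* B[X]) (φ : B →ₗ[K] K) (ω : B)
    (hE : ∀ q, InE φ q ↔ ∃ a, ε a = q) : ∃ f : A[X], f.map ε =
      (Polynomial.X ^ 2 - Polynomial.C (wT ω ^ 2) : B[X][X]) := by
  obtain ⟨a, ha⟩ := (hE (Polynomial.X ^ 2 * Polynomial.C (ω ^ 2))).1 inE_sq_mul
  refine ⟨Polynomial.X ^ 2 - Polynomial.C a, ?_⟩
  have e1 : (wT ω ^ 2) = Polynomial.X ^ 2 * Polynomial.C (ω ^ 2) := by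
    rw [wT, mul_pow, map_pow, mul_comm]
  rw [Polynomial.map_sub, Polynomial.map_pow, Polynomial.map_C, ha, Polynomial.map_X, e1]

set_option maxHeartbeats 1000000 in
theorem core (ε : A →+* B[X]) (φ : B →ₗ[K] K) (ω v : B)
    (hE : ∀ q, InE φ q ↔ ∃ a, ε a = q) (hφ1 : φ 1 = 0) (hω : φ ω ≠ 0) :
    ∃ a : A[X], a.Monic ∧ a.map ε = aPol ω v ∧
      (∀ g : A[X], (∀ f : A[X], (f.map ε).eval (wT ω) = 0 →
          ∃ s : A[X], (g * f).map ε = (a * s).map ε) →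
        ∃ c : B[X], c.coeff 0 = 0 ∧ φ (c.coeff 1) = 0 ∧
          (g.map ε).eval (wT ω) = Polynomial.C v * Polynomial.X ^ 2 * c) ∧
      (∀ c : B[X], c.coeff 0 = 0 → φ (c.coeff 1) = 0 →
        ∃ g : A[X], (∀ f : A[X], (f.map ε).eval (wT ω) = 0 →
          ∃ s : A[X], (g * f).map ε = (a * s).map ε) ∧
          (g.map ε).eval (wT ω) = Polynomial.C v * Polynomial.X ^ 2 * c) ∧
      (∀ f : A[X], (∀ g : A[X], (∀ f' : A[X], (f'.map ε).eval (wT ω) = 0 →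
          ∃ s : A[X], (g * f').map ε = (a * s).map ε) →
          ∃ s : A[X], (f * g).map ε = (a * s).map ε) → (f.map ε).eval (wT ω) = 0) := by
  have hnt : Nontrivial B := by
    by_contra h
    rw [not_nontrivial_iff_subsingleton] at h
    exact hω (by rw [Subsingleton.elim ω 0, map_zero])
  have hEc : ∀ (f : A[X]) (i : ℕ), InE φ ((f.map ε).coeff i) := fun f i => by
    rw [Polynomial.coeff_map]; exact (hE _).2 ⟨_, rfl⟩
  have hTw : (Polynomial.X - Polynomial.C (wT ω)).Monic := Polynomial.monic_X_sub_C _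
  obtain ⟨hr3, hrm⟩ := rPol_natDegree ω v
  have ham : (aPol ω v).Monic := hTw.mul hrm
  -- the lift of a
  have hlift := aPol_lift ε φ ω v hE
  obtain ⟨a, haε, had, hamon⟩ := Polynomial.lifts_and_natDegree_eq_and_monic hlift ham
  have had4 : a.natDegree = 4 := by
    rw [had, aPol, hTw.natDegree_mul hrm, hr3, Polynomial.natDegree_X_sub_C]
  have hreval : (rPol ω v).eval (wT ω) = Polynomial.C v * Polynomial.X ^ 2 := by
    simp [rPol]
  -- claim 2
  have claim2 : ∀ c : B[X], c.coeff 0 = 0 → φ (c.coeff 1) = 0 →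
        ∃ g : A[X], (g.map ε = Polynomial.C c * rPol ω v) ∧
        (∀ f : A[X], (f.map ε).eval (wT ω) = 0 →
          ∃ s : A[X], (g * f).map ε = (a * s).map ε) ∧
          (g.map ε).eval (wT ω) = Polynomial.C v * Polynomial.X ^ 2 * c := by
    intro c hc0 hc1
    have key : ∀ (f : A[X]) (s : B[X][X]), f.map ε = (Polynomial.X - Polynomial.C (wT ω)) * s →
        ∀ i, InE φ ((Polynomial.C c * s).coeff i) := by
      intro f s hs i
      rw [Polynomial.coeff_C_mul]
      apply mul_inE hc0 hc1
      obtain ⟨⟨l, hl⟩, -⟩ := hEc f (i + 1)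
      refine ⟨l, ?_⟩
      rw [← hl, hs, sub_mul, Polynomial.coeff_sub, Polynomial.coeff_X_mul, Polynomial.coeff_C_mul,
        Polynomial.coeff_sub, Polynomial.mul_coeff_zero, wT_coeff_zero, zero_mul, sub_zero]
    obtain ⟨g, hg⟩ := exists_lift hE (key a (rPol ω v) haε)
    refine ⟨g, hg, ?_, ?_⟩
    · intro f hf
      obtain ⟨s, hs⟩ := X_sub_eval hf
      obtain ⟨s', hs'⟩ := exists_lift hE (key f s hs)
      refine ⟨s', ?_⟩
      rw [Polynomial.map_mul, Polynomial.map_mul, hg, haε, hs', hs, aPol]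
      ring
    · rw [hg, Polynomial.eval_mul, Polynomial.eval_C, hreval]; ring
  refine ⟨a, hamon, haε, ?_, ?_, ?_⟩
  · intro g hg
    set g0 := g %ₘ a with hg0
    have hgd : g = g0 + a * (g /ₘ a) := (Polynomial.modByMonic_add_div g a).symm
    have haev : (a.map ε).eval (wT ω) = 0 := by rw [haε, aPol]; simp
    have hcol : ∀ f : A[X], (f.map ε).eval (wT ω) = 0 →
          ∃ s : A[X], (g0 * f).map ε = (a * s).map ε := by
      intro f hf
      obtain ⟨s, hs⟩ := hg f hf
      refine ⟨s - (g /ₘ a) * f, ?_⟩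
      have : g0 * f = g * f - a * ((g /ₘ a) * f) := by
        linear_combination (-f) * hgd
      rw [this, Polynomial.map_sub, hs, ← Polynomial.map_sub]; congr 1; ring
    have heval : (g.map ε).eval (wT ω) = (g0.map ε).eval (wT ω) := by
      conv_lhs => rw [hgd]
      rw [Polynomial.map_add, Polynomial.map_mul, Polynomial.eval_add, Polynomial.eval_mul, haev]
      simp
    rw [heval]
    -- q3
    obtain ⟨q3, hq3⟩ := q3_lift ε φ ω hφ1 hE
    obtain ⟨s, hs⟩ := hcol q3 (by rw [hq3]; simp)
    rw [Polynomial.map_mul, Polynomial.map_mul, hq3, haε, aPol] at hs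
    have hs2 : Polynomial.C Polynomial.X * g0.map ε = rPol ω v * s.map ε := by
      apply hTw.isRegular.left
      simp only
      linear_combination hs
    have hg0deg : (g0.map ε).natDegree ≤ 3 := by
      refine le_trans (Polynomial.natDegree_map_le) ?_
      have hA : Nontrivial A := by
        by_contra h
        rw [not_nontrivial_iff_subsingleton] at h
        have h1 : ε 1 = ε 0 := by rw [Subsingleton.elim (1 : A) 0]
        rw [map_one, map_zero] at h1
        exact one_ne_zero h1
      have : g0.natDegree < a.natDegree := Polynomial.natDegree_modByMonic_lt g hamon (by
        intro h; rw [h] at had4; simp at had4)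
      omega
    have hsd : (s.map ε).natDegree = 0 := by
      by_cases h0 : s.map ε = 0
      · rw [h0]; simp
      · have h1 := hrm.natDegree_mul' h0
        rw [← hs2, hr3] at h1
        have h2 := Polynomial.natDegree_C_mul_le (Polynomial.X : B[X]) (g0.map ε)
        omega
    set c := (s.map ε).coeff 0 with hc
    have hsc : s.map ε = Polynomial.C c := Polynomial.eq_C_of_natDegree_eq_zero hsd
    set c' := (g0.map ε).coeff 3 with hc'
    have hcc : Polynomial.X * c' = c := by
      have := congrArg (fun p => Polynomial.coeff p 3) hs2
      simp only [hsc, Polynomial.coeff_C_mul, Polynomial.coeff_mul_C] at this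
      have h3 : (rPol ω v).coeff 3 = 1 := by
        have := hrm.coeff_natDegree; rwa [hr3] at this
      rw [h3, one_mul] at this
      exact this
    have hg0r : g0.map ε = Polynomial.C c' * rPol ω v := by
      apply CX_cancel
      rw [hs2, hsc, ← hcc, map_mul]; ring
    have hc'E : InE φ c' := hEc g0 3
    obtain ⟨q4, hq4⟩ := q4_lift ε φ ω hE
    obtain ⟨s2, hs2'⟩ := hcol q4 (by rw [hq4]; simp)
    rw [Polynomial.map_mul, Polynomial.map_mul, hq4, haε, aPol, hg0r] at hs2'
    have hs3 : Polynomial.C c' * (Polynomial.X + Polynomial.C (wT ω)) = s2.map ε := by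
      apply (hTw.mul hrm).isRegular.left
      simp only
      rw [← hs2', map_pow]; ring
    have hE0 := hEc s2 0
    rw [← hs3] at hE0
    have e5 : (Polynomial.C c' * (Polynomial.X + Polynomial.C (wT ω))).coeff 0 = c' * wT ω := by
      rw [Polynomial.coeff_C_mul]; simp
    rw [e5] at hE0
    obtain ⟨⟨l, hl⟩, hc1⟩ := hc'E
    have hl0 : l = 0 := by
      have h := hE0.2
      rw [Polynomial.mul_coeff_one, hl, wT_coeff_zero, mul_zero, add_zero, ← Algebra.smul_def] at h
      have e6 : (wT ω).coeff 1 = ω := by simp [wT]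
      rw [e6, map_smul, smul_eq_mul] at h
      exact (mul_eq_zero.1 h).resolve_right hω
    refine ⟨c', by rw [hl, hl0, map_zero], hc1, ?_⟩
    rw [hg0r, Polynomial.eval_mul, Polynomial.eval_C, hreval]; ring
  · intro c hc0 hc1
    obtain ⟨g, -, h1, h2⟩ := claim2 c hc0 hc1
    exact ⟨g, h1, h2⟩
  · intro f hf
    obtain ⟨g, hgr, h1, h2⟩ := claim2 Polynomial.X (by simp) (by simp [hφ1])
    obtain ⟨s, hs⟩ := hf g h1
    rw [Polynomial.map_mul, Polynomial.map_mul, hgr, haε, aPol] at hs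
    have : Polynomial.C Polynomial.X * f.map ε =
        (Polynomial.X - Polynomial.C (wT ω)) * s.map ε := by
      apply hrm.isRegular.left
      simp only
      linear_combination hs
    have h := congrArg (Polynomial.eval (wT ω)) this
    simp only [Polynomial.eval_mul, Polynomial.eval_C, Polynomial.eval_sub, Polynomial.eval_X,
      sub_self, zero_mul] at h
    exact Polynomial.monic_X.isRegular.left (by simpa using h)

end CorePart

section RingA
set_option maxSynthPendingDepth 6
variable {K : Type*} [Field K] {B : Type*} [CommRing B] [Algebra K B]

abbrev A3 (K : Type*) [Field K] := Polynomial (Polynomial (Polynomial K))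

def yA : A3 K := Polynomial.X
def zA : A3 K := Polynomial.C Polynomial.X
def sA (s : Polynomial K) : A3 K := Polynomial.C (Polynomial.C s)
def xA : A3 K := sA Polynomial.X
def kA (a : K) : A3 K := sA (Polynomial.C a)
def g1A (α a0 a1 a2 : K) : A3 K :=
  yA * yA - kA α * (yA * zA) - xA * (kA a0 * xA + kA a1 * yA + kA a2 * zA)
def g2A (γ b0 b1 b2 : K) : A3 K :=
  zA * zA - kA γ * (yA * zA) - xA * (kA b0 * xA + kA b1 * yA + kA b2 * zA)

def epsA (η ζ : B) : A3 K →+* Polynomial B :=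
  Polynomial.eval₂RingHom (Polynomial.eval₂RingHom (Polynomial.mapRingHom (algebraMap K B))
    (Polynomial.C ζ * Polynomial.X)) (Polynomial.C η * Polynomial.X)

lemma epsA_s (η ζ : B) (s : Polynomial K) : epsA η ζ (sA s) = s.map (algebraMap K B) := by
  simp [epsA, sA]
lemma epsA_x (η ζ : B) : epsA (K := K) η ζ xA = Polynomial.X := by
  rw [xA, epsA_s]; simp
lemma epsA_k (η ζ : B) (a : K) : epsA η ζ (kA a) = Polynomial.C (algebraMap K B a) := by
  rw [kA, epsA_s]; simp
lemma epsA_y (η ζ : B) : epsA (K := K) η ζ yA = Polynomial.C η * Polynomial.X := by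
  simp [epsA, yA]
lemma epsA_z (η ζ : B) : epsA (K := K) η ζ zA = Polynomial.C ζ * Polynomial.X := by
  simp [epsA, zA]

lemma epsA_sub (η ζ : B) (f g : A3 K) : epsA η ζ (f - g) = epsA η ζ f - epsA η ζ g :=
  RingHom.map_sub _ _ _

lemma smul_A (s : Polynomial K) (f : A3 K) : s • f = sA s * f := by
  rw [sA, Polynomial.C_mul', Polynomial.smul_eq_C_mul]
  ext1 n
  simp [Polynomial.smul_eq_C_mul]

/-- the module of reducible elements -/
def redM (g1 g2 : A3 K) : Submodule (Polynomial K) (A3 K) :=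
  (Ideal.span {g1, g2}).restrictScalars (Polynomial K) ⊔
    Submodule.span (Polynomial K) {1, yA, zA, yA * zA}

lemma redM_top (α γ a0 a1 a2 b0 b1 b2 : K) (hαγ : 1 - α * γ ≠ 0) (f : A3 K) :
    f ∈ redM (g1A α a0 a1 a2) (g2A γ b0 b1 b2) := by
  set M := redM (g1A α a0 a1 a2) (g2A γ b0 b1 b2) with hM
  have hs : ∀ (s : Polynomial K) f, f ∈ M → sA s * f ∈ M := fun s f hf => by
    rw [← smul_A]; exact M.smul_mem s hf
  have hI : ∀ f, f ∈ Ideal.span {g1A α a0 a1 a2, g2A γ b0 b1 b2} → f ∈ M := fun f hf =>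
    (le_sup_left : _ ≤ M) hf
  have hS : ∀ f ∈ ({1, yA, zA, yA * zA} : Set (A3 K)), f ∈ M := fun f hf =>
    (le_sup_right : _ ≤ M) (Submodule.subset_span hf)
  have m1 : (1 : A3 K) ∈ M := hS _ (by simp)
  have my : (yA : A3 K) ∈ M := hS _ (by simp)
  have mz : (zA : A3 K) ∈ M := hS _ (by simp)
  have myz : (yA * zA : A3 K) ∈ M := hS _ (by simp)
  have mg1 : ∀ r, r * g1A α a0 a1 a2 ∈ M := fun r => hI _ (Ideal.mul_mem_left _ _
    (Ideal.subset_span (by simp)))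
  have mg2 : ∀ r, r * g2A γ b0 b1 b2 ∈ M := fun r => hI _ (Ideal.mul_mem_left _ _
    (Ideal.subset_span (by simp)))
  have mx : ∀ f, f ∈ M → xA * f ∈ M := fun f hf => hs _ f hf
  have mk : ∀ a f, f ∈ M → kA a * f ∈ M := fun a f hf => hs _ f hf
  have hlin : ∀ a b c : K, kA a * xA + kA b * yA + kA c * zA ∈ M := fun a b c =>
    add_mem (add_mem (mk _ _ (by simpa using mx 1 m1)) (mk _ _ my)) (mk _ _ mz)
  have myy : (yA * yA : A3 K) ∈ M := by
    have : (yA * yA : A3 K) = 1 * g1A α a0 a1 a2 + kA α * (yA * zA) +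
        xA * (kA a0 * xA + kA a1 * yA + kA a2 * zA) := by rw [g1A]; ring
    rw [this]
    exact add_mem (add_mem (mg1 _) (mk _ _ myz)) (mx _ (hlin _ _ _))
  have mzz : (zA * zA : A3 K) ∈ M := by
    have : (zA * zA : A3 K) = 1 * g2A γ b0 b1 b2 + kA γ * (yA * zA) +
        xA * (kA b0 * xA + kA b1 * yA + kA b2 * zA) := by rw [g2A]; ring
    rw [this]
    exact add_mem (add_mem (mg2 _) (mk _ _ myz)) (mx _ (hlin _ _ _))
  have hk : ∀ r : A3 K, r = kA (1 - α * γ)⁻¹ * ((1 - kA α * kA γ) * r) := by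
    intro r
    have : (kA (1 - α * γ)⁻¹ * (1 - kA α * kA γ) : A3 K) = 1 := by
      have h1 : (1 - kA α * kA γ : A3 K) = kA (1 - α * γ) := by
        simp [kA, sA]
      rw [h1, kA, kA, sA, sA, ← map_mul, ← map_mul, ← map_mul, inv_mul_cancel₀ hαγ]
      simp
    rw [← mul_assoc, this, one_mul]
  have hlz : ∀ a b c : K, xA * (kA a * (xA * zA) + kA b * (yA * zA) + kA c * (zA * zA)) ∈ M :=
    fun a b c => mx _ (add_mem (add_mem (mk _ _ (mx _ mz)) (mk _ _ myz)) (mk _ _ mzz))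
  have hly : ∀ a b c : K, xA * (kA a * (xA * yA) + kA b * (yA * yA) + kA c * (yA * zA)) ∈ M :=
    fun a b c => mx _ (add_mem (add_mem (mk _ _ (mx _ my)) (mk _ _ myy)) (mk _ _ myz))
  have myyz : (yA * (yA * zA) : A3 K) ∈ M := by
    rw [hk (yA * (yA * zA))]
    apply mk
    have : ((1 - kA α * kA γ) * (yA * (yA * zA)) : A3 K) = zA * g1A α a0 a1 a2 +
        kA α * (yA * g2A γ b0 b1 b2) +
        xA * (kA a0 * (xA * zA) + kA a1 * (yA * zA) + kA a2 * (zA * zA)) +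
        kA α * (xA * (kA b0 * (xA * yA) + kA b1 * (yA * yA) + kA b2 * (yA * zA))) := by
      rw [g1A, g2A]; ring
    rw [this]
    exact add_mem (add_mem (add_mem (mg1 _) (mk _ _ (mg2 _))) (hlz _ _ _)) (mk _ _ (hly _ _ _))
  have mzyz : (zA * (yA * zA) : A3 K) ∈ M := by
    rw [hk (zA * (yA * zA))]
    apply mk
    have : ((1 - kA α * kA γ) * (zA * (yA * zA)) : A3 K) = yA * g2A γ b0 b1 b2 +
        kA γ * (zA * g1A α a0 a1 a2) +
        xA * (kA b0 * (xA * yA) + kA b1 * (yA * yA) + kA b2 * (yA * zA)) +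
        kA γ * (xA * (kA a0 * (xA * zA) + kA a1 * (yA * zA) + kA a2 * (zA * zA))) := by
      rw [g1A, g2A]; ring
    rw [this]
    exact add_mem (add_mem (add_mem (mg2 _) (mk _ _ (mg1 _))) (hly _ _ _)) (mk _ _ (hlz _ _ _))
  have clos : ∀ u : A3 K, (∀ r ∈ ({1, yA, zA, yA * zA} : Set (A3 K)), u * r ∈ M) →
      ∀ f ∈ M, u * f ∈ M := by
    intro u hu f hf
    rw [hM, redM, Submodule.mem_sup] at hf
    obtain ⟨i, hi, w, hw, rfl⟩ := hf
    rw [mul_add]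
    refine add_mem (hI _ (Ideal.mul_mem_left _ _ hi)) ?_
    induction hw using Submodule.span_induction with
    | mem x h => exact hu x h
    | zero => simp
    | add x y _ _ hx hy => rw [mul_add]; exact add_mem hx hy
    | smul a x _ hx => rw [mul_smul_comm]; exact M.smul_mem _ hx
  have cy : ∀ f ∈ M, yA * f ∈ M := clos yA (by
    rintro r (rfl | rfl | rfl | rfl)
    · simpa using my
    · exact myy
    · exact myz
    · exact myyz)
  have cz : ∀ f ∈ M, zA * f ∈ M := clos zA (by
    rintro r (rfl | rfl | rfl | rfl)
    · simpa using mz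
    · have e : (zA * yA : A3 K) = yA * zA := by ring
      rw [e]; exact myz
    · exact mzz
    · exact mzyz)
  have hR : ∀ r : Polynomial (Polynomial K), (Polynomial.C r : A3 K) ∈ M := by
    intro r
    induction r using Polynomial.induction_on with
    | C a => simpa [sA] using hs a 1 m1
    | add p q hp hq => rw [map_add]; exact add_mem hp hq
    | monomial n a h =>
      have : (Polynomial.C (Polynomial.C a * Polynomial.X ^ (n + 1)) : A3 K) =
          zA * Polynomial.C (Polynomial.C a * Polynomial.X ^ n) := by
        rw [zA, ← map_mul]; congr 1; ring
      rw [this]; exact cz _ h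
  induction f using Polynomial.induction_on with
  | C a => exact hR a
  | add p q hp hq => exact add_mem hp hq
  | monomial n a h =>
    have : (Polynomial.C a * Polynomial.X ^ (n + 1) : A3 K) =
        yA * (Polynomial.C a * Polynomial.X ^ n) := by
      rw [yA]; ring
    rw [this]; exact cy _ h

lemma red_exists (α γ a0 a1 a2 b0 b1 b2 : K) (hαγ : 1 - α * γ ≠ 0) (f : A3 K) :
    ∃ s0 s1 s2 s3 : Polynomial K, f - (sA s0 + sA s1 * yA + sA s2 * zA + sA s3 * (yA * zA)) ∈
      Ideal.span {g1A α a0 a1 a2, g2A γ b0 b1 b2} := by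
  have := redM_top α γ a0 a1 a2 b0 b1 b2 hαγ f
  rw [redM, Submodule.mem_sup] at this
  obtain ⟨i, hi, w, hw, rfl⟩ := this
  rw [Submodule.mem_span_insert] at hw
  obtain ⟨s0, w, hw, rfl⟩ := hw
  rw [Submodule.mem_span_insert] at hw
  obtain ⟨s1, w, hw, rfl⟩ := hw
  rw [Submodule.mem_span_pair] at hw
  obtain ⟨s2, s3, rfl⟩ := hw
  refine ⟨s0, s1, s2, s3, ?_⟩
  simp only [smul_A, mul_one]
  have : i + (sA s0 + (sA s1 * yA + (sA s2 * zA + sA s3 * (yA * zA)))) -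
    (sA s0 + sA s1 * yA + sA s2 * zA + sA s3 * (yA * zA)) = i := by ring
  rw [this]
  exact hi

section
variable {η ζ : B} {α γ a0 a1 a2 b0 b1 b2 : K}

lemma eps_g1 (h : η * η = α • (η * ζ) + (a0 • 1 + a1 • η + a2 • ζ)) :
    epsA η ζ (g1A α a0 a1 a2) = 0 := by
  simp only [g1A, epsA_sub, map_mul, map_add, epsA_y, epsA_z, epsA_x, epsA_k]
  have h' := congrArg (fun r => Polynomial.C r * Polynomial.X ^ 2) h
  simp only [Algebra.smul_def, mul_one, map_mul, map_add] at h'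
  linear_combination h'

lemma eps_g2 (h : ζ * ζ = γ • (η * ζ) + (b0 • 1 + b1 • η + b2 • ζ)) :
    epsA η ζ (g2A γ b0 b1 b2) = 0 := by
  simp only [g2A, epsA_sub, map_mul, map_add, epsA_y, epsA_z, epsA_x, epsA_k]
  have h' := congrArg (fun r => Polynomial.C r * Polynomial.X ^ 2) h
  simp only [Algebra.smul_def, mul_one, map_mul, map_add] at h'
  linear_combination h'

lemma eps_ideal (h1 : η * η = α • (η * ζ) + (a0 • 1 + a1 • η + a2 • ζ))
    (h2 : ζ * ζ = γ • (η * ζ) + (b0 • 1 + b1 • η + b2 • ζ)) {f : A3 K}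
    (hf : f ∈ Ideal.span {g1A α a0 a1 a2, g2A γ b0 b1 b2}) : epsA η ζ f = 0 := by
  have : Ideal.span {g1A α a0 a1 a2, g2A γ b0 b1 b2} ≤ RingHom.ker (epsA (K := K) η ζ) := by
    rw [Ideal.span_le]
    rintro x (rfl | rfl)
    · exact eps_g1 h1
    · exact eps_g2 h2
  exact this hf

lemma eps_red (s0 s1 s2 s3 : Polynomial K) (n : ℕ) :
    (epsA η ζ (sA s0 + sA s1 * yA + sA s2 * zA + sA s3 * (yA * zA))).coeff n =
      s0.coeff n • (1 : B) + (Polynomial.X * s1).coeff n • η + (Polynomial.X * s2).coeff n • ζ +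
        (Polynomial.X ^ 2 * s3).coeff n • (η * ζ) := by
  simp only [map_add, map_mul, epsA_y, epsA_z, epsA_s]
  have e : ∀ (s : Polynomial K) (m : ℕ) (b : B), (s.map (algebraMap K B) * (Polynomial.C b *
      Polynomial.X ^ m)).coeff n = (Polynomial.X ^ m * s).coeff n • b := by
    intro s m b
    have : s.map (algebraMap K B) * (Polynomial.C b * Polynomial.X ^ m) =
        Polynomial.C b * (Polynomial.X ^ m * s).map (algebraMap K B) := by
      rw [Polynomial.map_mul, Polynomial.map_pow, Polynomial.map_X]; ring
    rw [this, Polynomial.coeff_C_mul, Polynomial.coeff_map, Algebra.smul_def, mul_comm]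
  have e0 := e s0 0 1
  have e1 := e s1 1 η
  have e2 := e s2 1 ζ
  have e3 := e s3 2 (η * ζ)
  simp only [pow_zero, pow_one, map_one, mul_one, one_mul] at e0 e1 e2
  have e4 : Polynomial.C η * Polynomial.X * (Polynomial.C ζ * Polynomial.X) =
      Polynomial.C (η * ζ) * Polynomial.X ^ 2 := by rw [map_mul]; ring
  rw [e4, Polynomial.coeff_add, Polynomial.coeff_add, Polynomial.coeff_add, e0, e1, e2, e3]

lemma eps_ker (h1 : η * η = α • (η * ζ) + (a0 • 1 + a1 • η + a2 • ζ))
    (h2 : ζ * ζ = γ • (η * ζ) + (b0 • 1 + b1 • η + b2 • ζ)) (hαγ : 1 - α * γ ≠ 0)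
    (hli : LinearIndependent K ![1, η, ζ, η * ζ]) (f : A3 K) :
    f ∈ Ideal.span {g1A α a0 a1 a2, g2A γ b0 b1 b2} ↔ epsA η ζ f = 0 := by
  refine ⟨eps_ideal h1 h2, fun hf => ?_⟩
  obtain ⟨s0, s1, s2, s3, hs⟩ := red_exists α γ a0 a1 a2 b0 b1 b2 hαγ f
  have h0 := eps_ideal h1 h2 hs
  rw [epsA_sub, hf, zero_sub, neg_eq_zero] at h0
  rw [Fintype.linearIndependent_iff] at hli
  have hc : ∀ n, s0.coeff n = 0 ∧ (Polynomial.X * s1).coeff n = 0 ∧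
      (Polynomial.X * s2).coeff n = 0 ∧ (Polynomial.X ^ 2 * s3).coeff n = 0 := by
    intro n
    have := congrArg (fun p => Polynomial.coeff p n) h0
    simp only [eps_red, Polynomial.coeff_zero] at this
    have := hli ![s0.coeff n, (Polynomial.X * s1).coeff n, (Polynomial.X * s2).coeff n,
      (Polynomial.X ^ 2 * s3).coeff n] (by simpa [Fin.sum_univ_four] using this)
    exact ⟨this 0, this 1, this 2, this 3⟩
  have z0 : s0 = 0 := by ext n; simpa using (hc n).1
  have z1 : s1 = 0 := by
    have : Polynomial.X * s1 = 0 := by ext n; simpa using (hc n).2.1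
    simpa using this
  have z2 : s2 = 0 := by
    have : Polynomial.X * s2 = 0 := by ext n; simpa using (hc n).2.2.1
    simpa using this
  have z3 : s3 = 0 := by
    have : Polynomial.X ^ 2 * s3 = 0 := by ext n; simpa using (hc n).2.2.2
    simpa using this
  rw [z0, z1, z2, z3] at hs
  simpa [sA] using hs

lemma eps_range (h1 : η * η = α • (η * ζ) + (a0 • 1 + a1 • η + a2 • ζ))
    (h2 : ζ * ζ = γ • (η * ζ) + (b0 • 1 + b1 • η + b2 • ζ)) (hαγ : 1 - α * γ ≠ 0)
    (b : Module.Basis (Fin 4) K B) (hb : ⇑b = ![1, η, ζ, η * ζ]) (φ : B →ₗ[K] K)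
    (hφ1 : φ 1 = 0) (hη : φ η = 0) (hζ : φ ζ = 0) (hω : φ (η * ζ) ≠ 0) (q : Polynomial B) :
    InE φ q ↔ ∃ a, epsA (K := K) η ζ a = q := by
  constructor
  · intro hq
    have hrep : ∀ x : B, x = b.repr x 3 • (η * ζ) +
        (b.repr x 0 • 1 + b.repr x 1 • η + b.repr x 2 • ζ) := by
      intro x
      conv_lhs => rw [← b.sum_repr x]
      simp only [hb, Fin.sum_univ_four, Matrix.cons_val_zero, Matrix.cons_val_one, Matrix.cons_val]
      abel
    change q ∈ RingHom.rangeS (epsA (K := K) η ζ)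
    rw [q.as_sum_range_C_mul_X_pow]
    apply sum_mem
    rintro n -
    obtain ⟨⟨l, hl⟩, hq1⟩ := hq
    rcases n with _ | _ | n
    · refine ⟨kA l, ?_⟩
      rw [epsA_k, hl]; simp
    · set x := q.coeff 1
      have hx3 : b.repr x 3 = 0 := by
        rw [hrep x] at hq1
        simp only [map_add, map_smul, hφ1, hη, hζ, smul_eq_mul, mul_zero, add_zero] at hq1
        exact (mul_eq_zero.1 hq1).resolve_right hω
      refine ⟨kA (b.repr x 0) * xA + kA (b.repr x 1) * yA + kA (b.repr x 2) * zA, ?_⟩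
      simp only [map_add, map_mul, epsA_x, epsA_y, epsA_z, epsA_k]
      conv_rhs => rw [zero_add]; change Polynomial.C x * _; rw [hrep x, hx3]
      simp only [Algebra.smul_def, map_mul, map_add, map_zero, map_one]; ring
    · set x := q.coeff (n + 1 + 1)
      refine ⟨xA ^ n * (kA (b.repr x 0) * xA ^ 2 + kA (b.repr x 1) * (xA * yA) +
        kA (b.repr x 2) * (xA * zA) + kA (b.repr x 3) * (yA * zA)), ?_⟩
      simp only [map_add, map_mul, map_pow, epsA_x, epsA_y, epsA_z, epsA_k]
      conv_rhs => rw [hrep x]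
      simp only [Algebra.smul_def, map_mul, map_add, map_one]; ring
  · rintro ⟨f, rfl⟩
    obtain ⟨s0, s1, s2, s3, hs⟩ := red_exists α γ a0 a1 a2 b0 b1 b2 hαγ f
    have h0 := eps_ideal h1 h2 hs
    rw [epsA_sub, sub_eq_zero] at h0
    rw [h0]
    refine ⟨⟨s0.coeff 0, ?_⟩, ?_⟩
    · rw [eps_red]
      simp [Polynomial.mul_coeff_zero, Algebra.algebraMap_eq_smul_one]
    · rw [eps_red]
      simp [Polynomial.coeff_X_pow_mul', hφ1, hη, hζ]

end

/-- a general regularity criterion -/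
lemma monic_reg {R : Type*} [CommRing R] [IsDomain R] (g : Polynomial R) (hg : g.Monic)
    {N : R} (hN : N ≠ 0) (f : Polynomial R) (h : g ∣ Polynomial.C N * f) : g ∣ f := by
  rw [← Polynomial.modByMonic_eq_zero_iff_dvd hg] at h ⊢
  rw [Polynomial.C_mul', Polynomial.smul_modByMonic] at h
  exact (smul_eq_zero.1 h).resolve_left hN

lemma g1_dvd_of (α γ a0 a1 a2 b0 b1 b2 : K) (hαγ : 1 - α * γ ≠ 0) (f : A3 K)
    (h : g1A α a0 a1 a2 ∣ g2A γ b0 b1 b2 * f) : g1A α a0 a1 a2 ∣ f := by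
  let z : Polynomial (Polynomial K) := Polynomial.X
  let x : Polynomial (Polynomial K) := Polynomial.C Polynomial.X
  let u : K → Polynomial (Polynomial K) := fun a => Polynomial.C (Polynomial.C a)
  let b : Polynomial (Polynomial K) := - (u α * z + x * u a1)
  let c : Polynomial (Polynomial K) := - (x * (u a0 * x + u a2 * z))
  let A0 : Polynomial (Polynomial K) := z * z - x * (u b0 * x + u b2 * z)
  let B0 : Polynomial (Polynomial K) := - (u γ * z + x * u b1)
  have hg1 : g1A α a0 a1 a2 = Polynomial.X ^ 2 + (Polynomial.C b * Polynomial.X + Polynomial.C c) := by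
    simp only [g1A, yA, zA, xA, kA, sA, b, c, z, x, u, map_neg, map_mul, map_add]; ring
  have hg2 : g2A γ b0 b1 b2 = Polynomial.C A0 + Polynomial.C B0 * Polynomial.X := by
    simp only [g2A, yA, zA, xA, kA, sA, A0, B0, z, x, u, map_neg, map_mul, map_add, map_sub]; ring
  have hmon : (g1A α a0 a1 a2).Monic := by
    rw [hg1]
    apply Polynomial.monic_X_pow_add
    exact lt_of_le_of_lt Polynomial.degree_linear_le (by norm_num)
  let N := A0 ^ 2 - A0 * B0 * b + B0 ^ 2 * c
  have hN : N ≠ 0 := by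
    intro h0
    have := congrArg (Polynomial.map (Polynomial.evalRingHom (0 : K))) h0
    simp only [N, A0, B0, b, c, z, x, u, Polynomial.map_add, Polynomial.map_sub, Polynomial.map_mul,
      Polynomial.map_pow, Polynomial.map_neg, Polynomial.map_X, Polynomial.map_C,
      Polynomial.coe_evalRingHom, Polynomial.eval_C, Polynomial.eval_X, map_zero,
      Polynomial.map_zero] at this
    have h2 : (Polynomial.C (1 - α * γ) * Polynomial.X ^ 4 : Polynomial K) = 0 := by
      rw [← this]; simp only [map_sub, map_mul, map_one]; ring
    rw [mul_eq_zero] at h2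
    rcases h2 with h2 | h2
    · exact hαγ (Polynomial.C_eq_zero.1 h2)
    · exact absurd h2 (pow_ne_zero _ Polynomial.X_ne_zero)
  refine monic_reg _ hmon hN f ?_
  have e : Polynomial.C N * f = (Polynomial.C A0 - Polynomial.C B0 * Polynomial.C b -
      Polynomial.C B0 * Polynomial.X) * (g2A γ b0 b1 b2 * f) +
      g1A α a0 a1 a2 * (Polynomial.C B0 ^ 2 * f) := by
    rw [hg1, hg2]
    simp only [N, map_add, map_sub, map_mul, map_pow]; ring
  rw [e]
  exact dvd_add (Dvd.dvd.mul_left h _) (dvd_mul_right _ _)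

lemma g1A_ne_zero (α a0 a1 a2 : K) : g1A α a0 a1 a2 ≠ 0 := by
  intro h
  have := congrArg (fun p => Polynomial.coeff p 2) h
  simp [g1A, yA, zA, xA, kA, sA, Polynomial.coeff_X, Polynomial.coeff_C, mul_add, ← mul_assoc] at this

end RingA

section LinkPart
open scoped Polynomial

lemma isRegular3 {R : Type*} [CommRing R] (a b c : R) (h1 : ∀ f, a * f = 0 → f = 0)
    (h2 : ∀ f, b * f ∈ Ideal.span {a} → f ∈ Ideal.span {a})
    (h3 : ∀ f, c * f ∈ Ideal.span {a, b} → f ∈ Ideal.span {a, b})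
    (h4 : Ideal.span {a, b, c} ≠ ⊤) : RingTheory.Sequence.IsRegular R [a, b, c] := by
  have e1 : ({x : R | x = a} : Set R) = {a} := by ext; simp
  have e2 : ({x : R | x = a ∨ x = b} : Set R) = {a, b} := by ext; simp
  have e3 : ({x : R | x = a ∨ x = b ∨ x = c} : Set R) = {a, b, c} := by ext; simp
  refine ⟨⟨?_⟩, ?_⟩
  · intro i hi
    rw [isSMulRegular_quotient_iff_mem_of_smul_mem]
    intro f hf
    simp only [List.length_cons, List.length_nil] at hi
    interval_cases i
    · simp [Ideal.ofList] at hf ⊢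
      exact h1 f hf
    · simp [Ideal.ofList, e1] at hf ⊢
      exact h2 f hf
    · simp [Ideal.ofList, e2] at hf ⊢
      exact h3 f hf
  · intro h
    apply h4
    have h' := h.symm
    simpa [Ideal.ofList, e3] using h'

variable {K : Type*} [Field K] {B : Type*} [CommRing B] [Algebra K B] {A : Type*} [CommRing A]
  {P : Type*} [CommRing P]

lemma link_mem12 (σ : P ≃+* A[X]) (ε : A →+* B[X]) (g1 g2 : A)
    (hker : ∀ f, f ∈ Ideal.span {g1, g2} ↔ ε f = 0) (f : P) :
    f ∈ Ideal.span {σ.symm (Polynomial.C g1), σ.symm (Polynomial.C g2)} ↔ (σ f).map ε = 0 := by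
  constructor
  · intro hf
    obtain ⟨x, y, rfl⟩ := Ideal.mem_span_pair.1 hf
    have e1 : ε g1 = 0 := (hker _).1 (Ideal.subset_span (by simp))
    have e2 : ε g2 = 0 := (hker _).1 (Ideal.subset_span (by simp))
    simp [e1, e2]
  · intro hf
    have : σ f ∈ Ideal.map Polynomial.C (Ideal.span {g1, g2}) := by
      rw [Ideal.mem_map_C_iff]
      intro n
      rw [hker, ← Polynomial.coeff_map, hf, Polynomial.coeff_zero]
    rw [Ideal.map_span, Set.image_pair, Ideal.mem_span_pair] at this
    obtain ⟨x, y, h⟩ := this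
    rw [Ideal.mem_span_pair]
    refine ⟨σ.symm x, σ.symm y, ?_⟩
    rw [← map_mul, ← map_mul, ← map_add, h, σ.symm_apply_apply]

lemma link_mem123 (σ : P ≃+* A[X]) (ε : A →+* B[X]) (g1 g2 : A) (a : A[X])
    (hker : ∀ f, f ∈ Ideal.span {g1, g2} ↔ ε f = 0) (f : P) :
    f ∈ Ideal.span {σ.symm (Polynomial.C g1), σ.symm (Polynomial.C g2), σ.symm a} ↔
      ∃ s : A[X], (σ f).map ε = (a * s).map ε := by
  have e : ({σ.symm (Polynomial.C g1), σ.symm (Polynomial.C g2), σ.symm a} : Set P) =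
      {σ.symm a, σ.symm (Polynomial.C g1), σ.symm (Polynomial.C g2)} := by
    ext; simp; tauto
  rw [e, Ideal.mem_span_insert]
  constructor
  · rintro ⟨s, z, hz, rfl⟩
    rw [link_mem12 σ ε g1 g2 hker] at hz
    refine ⟨σ s, ?_⟩
    rw [map_add, Polynomial.map_add, hz, map_mul, σ.apply_symm_apply, add_zero, mul_comm]
  · rintro ⟨s, hs⟩
    refine ⟨σ.symm s, f - σ.symm s * σ.symm a, ?_, by ring⟩
    rw [link_mem12 σ ε g1 g2 hker, map_sub, Polynomial.map_sub, hs, map_mul, σ.apply_symm_apply,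
      σ.apply_symm_apply, mul_comm, sub_self]

theorem link (σ : P ≃+* A[X]) (ε : A →+* B[X]) (φ : B →ₗ[K] K) (ω v : B)
    (hE : ∀ q, InE φ q ↔ ∃ a, ε a = q) (hφ1 : φ 1 = 0) (hω : φ ω ≠ 0) (g1 g2 : A)
    (hker : ∀ f, f ∈ Ideal.span {g1, g2} ↔ ε f = 0) (hreg1 : ∀ f, g1 * f = 0 → f = 0)
    (hreg2 : ∀ f, g1 ∣ g2 * f → g1 ∣ f) (π : P →+* B[X])
    (hπ : ∀ f, π f = ((σ f).map ε).eval (wT ω)) :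
    ∃ a1 a2 a3 : P, RingTheory.Sequence.IsRegular P [a1, a2, a3] ∧
      Ideal.span {a1, a2, a3} ≤ RingHom.ker π ∧
      (Ideal.span {a1, a2, a3}).colon ((Ideal.span {a1, a2, a3}).colon (RingHom.ker π : Set P) : Set P) =
        RingHom.ker π ∧
      (∀ g ∈ (Ideal.span {a1, a2, a3}).colon (RingHom.ker π : Set P),
        ∃ c : B[X], c.coeff 0 = 0 ∧ φ (c.coeff 1) = 0 ∧
          π g = Polynomial.C v * Polynomial.X ^ 2 * c) ∧
      (∀ c : B[X], c.coeff 0 = 0 → φ (c.coeff 1) = 0 →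
        ∃ g ∈ (Ideal.span {a1, a2, a3}).colon (RingHom.ker π : Set P),
          π g = Polynomial.C v * Polynomial.X ^ 2 * c) ∧
      (aPol ω v).Monic ∧
      (∀ f, f ∈ Ideal.span {a1, a2, a3} ↔ ((σ f).map ε) %ₘ (aPol ω v) = 0) := by
  have hnt : Nontrivial B := by
    by_contra h
    rw [not_nontrivial_iff_subsingleton] at h
    exact hω (by rw [Subsingleton.elim ω 0, map_zero])
  obtain ⟨a, hamon, haε, c1, c2, c3⟩ := core ε φ ω v hE hφ1 hω
  have ham : (aPol ω v).Monic := haε ▸ hamon.map ε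
  have m12 := link_mem12 σ ε g1 g2 hker
  have m123 := link_mem123 σ ε g1 g2 a hker
  have m1 : ∀ f, f ∈ Ideal.span {σ.symm (Polynomial.C g1)} ↔ ∀ n, g1 ∣ (σ f).coeff n := by
    intro f
    rw [Ideal.mem_span_singleton, ← Polynomial.C_dvd_iff_dvd_coeff]
    constructor
    · rintro ⟨r, rfl⟩; exact ⟨σ r, by simp⟩
    · rintro ⟨r, hr⟩
      refine ⟨σ.symm r, ?_⟩
      rw [← map_mul, ← hr, σ.symm_apply_apply]
  have haw : (aPol ω v).eval (wT ω) = 0 := by simp [aPol]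
  have hle : Ideal.span {σ.symm (Polynomial.C g1), σ.symm (Polynomial.C g2), σ.symm a} ≤
      RingHom.ker π := by
    intro f hf
    obtain ⟨s, hs⟩ := (m123 f).1 hf
    rw [RingHom.mem_ker, hπ, hs, Polynomial.map_mul, haε, Polynomial.eval_mul, haw, zero_mul]
  have mcol : ∀ g : P, g ∈ (Ideal.span {σ.symm (Polynomial.C g1), σ.symm (Polynomial.C g2),
      σ.symm a}).colon (RingHom.ker π : Set P) ↔ ∀ f : A[X], (f.map ε).eval (wT ω) = 0 →
          ∃ s : A[X], (σ g * f).map ε = (a * s).map ε := by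
    intro g
    rw [Submodule.mem_colon]
    constructor
    · intro h f hf
      have := (m123 _).1 (h (σ.symm f) (by
        rw [SetLike.mem_coe, RingHom.mem_ker, hπ, σ.apply_symm_apply, hf]))
      simpa using this
    · intro h f hf
      rw [SetLike.mem_coe, RingHom.mem_ker, hπ] at hf
      rw [m123, smul_eq_mul, map_mul]
      exact h _ hf
  refine ⟨σ.symm (Polynomial.C g1), σ.symm (Polynomial.C g2), σ.symm a, ?_, hle, ?_, ?_, ?_,
    ham, ?_⟩
  · apply isRegular3
    · intro f hf
      have := congrArg σ hf
      rw [map_mul, σ.apply_symm_apply, map_zero] at this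
      have h0 : σ f = 0 := by
        ext n
        have := congrArg (fun p => Polynomial.coeff p n) this
        simp only [Polynomial.coeff_C_mul, Polynomial.coeff_zero] at this
        exact hreg1 _ this
      exact (map_eq_zero_iff σ σ.injective).1 h0
    · intro f hf
      rw [m1] at hf ⊢
      intro n
      have := hf n
      rw [map_mul, σ.apply_symm_apply, Polynomial.coeff_C_mul] at this
      exact hreg2 _ this
    · intro f hf
      rw [m12] at hf ⊢
      rw [map_mul, σ.apply_symm_apply, Polynomial.map_mul, haε] at hf
      exact ham.mul_right_eq_zero_iff.1 hf
    · intro h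
      have : (1 : P) ∈ RingHom.ker π := hle (h ▸ Submodule.mem_top)
      rw [RingHom.mem_ker, map_one] at this
      exact one_ne_zero this
  · apply le_antisymm
    · intro f hf
      rw [Submodule.mem_colon] at hf
      rw [RingHom.mem_ker, hπ]
      apply c3
      intro g hg
      have := (m123 _).1 (hf (σ.symm g) ((mcol _).2 (by rwa [σ.apply_symm_apply])))
      simpa using this
    · intro f hf
      rw [Submodule.mem_colon]
      intro g hg
      rw [SetLike.mem_coe, Submodule.mem_colon] at hg
      rw [smul_eq_mul, mul_comm]
      exact hg f hf
  · intro g hg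
    rw [hπ]
    exact c1 _ ((mcol g).1 hg)
  · intro c h0 h1
    obtain ⟨g, hg, hgc⟩ := c2 c h0 h1
    refine ⟨σ.symm g, (mcol _).2 (by rwa [σ.apply_symm_apply]), ?_⟩
    rw [hπ, σ.apply_symm_apply, hgc]
  · intro f
    rw [m123, Polynomial.modByMonic_eq_zero_iff_dvd ham]
    constructor
    · rintro ⟨s, hs⟩
      rw [hs, Polynomial.map_mul, haε]; exact dvd_mul_right _ _
    · intro h
      refine ⟨σ f /ₘ a, ?_⟩
      have e := Polynomial.modByMonic_add_div (σ f) a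
      have e2 : (σ f %ₘ a).map ε = 0 := by
        rw [Polynomial.map_modByMonic ε hamon, haε, Polynomial.modByMonic_eq_zero_iff_dvd ham]
        exact h
      conv_lhs => rw [← e]
      rw [Polynomial.map_add, e2, zero_add]

end LinkPart

section SigmaPart
set_option maxSynthPendingDepth 6
variable {K : Type*} [Field K] {B : Type*} [CommRing B] [Algebra K B]

lemma algQ (a : K) : algebraMap K (Polynomial (A3 K)) a = Polynomial.C (kA a) := rfl

def yQ : Fin 4 → Polynomial (A3 K) :=
  ![Polynomial.C xA, Polynomial.C yA, Polynomial.C zA, Polynomial.X]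

def tauQ {R : Type*} [CommRing R] [Algebra K R] (r : Fin 4 → R) : Polynomial (A3 K) →ₐ[K] R where
  toRingHom := Polynomial.eval₂RingHom (Polynomial.eval₂RingHom (Polynomial.eval₂RingHom
    (Polynomial.eval₂RingHom (algebraMap K R) (r 0)) (r 2)) (r 1)) (r 3)
  commutes' a := by
    rw [algQ]
    simp [kA, sA]

lemma tauQ_y {R : Type*} [CommRing R] [Algebra K R] (r : Fin 4 → R) (i : Fin 4) :
    tauQ (K := K) r (yQ i) = r i := by
  fin_cases i <;> simp [tauQ, yQ, xA, yA, zA, sA]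

lemma hom_extQ {R : Type*} [CommRing R] [Algebra K R] (f g : Polynomial (A3 K) →ₐ[K] R)
    (h : ∀ i, f (yQ i) = g (yQ i)) : f = g := by
  have : (f : Polynomial (A3 K) →+* R) = g := by
    apply Polynomial.ringHom_ext' _ (h 3)
    apply Polynomial.ringHom_ext' _ (h 1)
    apply Polynomial.ringHom_ext' _ (h 2)
    apply Polynomial.ringHom_ext' _ (h 0)
    ext a
    exact (f.commutes a).trans (g.commutes a).symm
  exact AlgHom.coe_ringHom_injective this

def sigP (b c : Module.Basis (Fin 4) K B) : MvPolynomial (Fin 4) K ≃ₐ[K] Polynomial (A3 K) :=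
  have e1 : ∀ x, MvPolynomial.aeval (fun i => b.constr K (yQ (K := K)) (c i))
      (c.constr K (fun i => (X i : MvPolynomial (Fin 4) K)) x) = b.constr K (yQ (K := K)) x := by
    intro x
    change ((MvPolynomial.aeval (fun i => b.constr K (yQ (K := K)) (c i))).toLinearMap ∘ₗ
      (c.constr K (fun i => (X i : MvPolynomial (Fin 4) K)))) x = _
    congr 1
    apply c.ext
    intro i
    simp [Module.Basis.constr_basis]
  have e2 : ∀ x, tauQ (K := K) (fun i => c.constr K (fun i => (X i : MvPolynomial (Fin 4) K)) (b i))
      (b.constr K (yQ (K := K)) x) = c.constr K (fun i => (X i : MvPolynomial (Fin 4) K)) x := by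
    intro x
    change ((tauQ (K := K) (fun i => c.constr K
      (fun i => (X i : MvPolynomial (Fin 4) K)) (b i))).toLinearMap ∘ₗ
      (b.constr K (yQ (K := K)))) x = _
    congr 1
    apply b.ext
    intro i
    simp [Module.Basis.constr_basis, tauQ_y]
  AlgEquiv.ofAlgHom (MvPolynomial.aeval (fun i => b.constr K (yQ (K := K)) (c i)))
    (tauQ (fun i => c.constr K (fun i => (X i : MvPolynomial (Fin 4) K)) (b i)))
    (hom_extQ _ _ fun i => by
      rw [AlgHom.comp_apply, tauQ_y, e1, Module.Basis.constr_basis]; rfl)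
    (MvPolynomial.algHom_ext fun i => by
      rw [AlgHom.comp_apply, aeval_X, e2, Module.Basis.constr_basis]; rfl)

lemma sigP_X (b c : Module.Basis (Fin 4) K B) (i : Fin 4) :
    sigP b c (X i) = b.constr K (yQ (K := K)) (c i) := by
  exact aeval_X _ _

lemma sigP_pi (b c : Module.Basis (Fin 4) K B) (η ζ : B) (hb : ⇑b = ![1, η, ζ, η * ζ])
    (f : MvPolynomial (Fin 4) K) :
    piMap (K := K) c f = ((sigP b c f).map (epsA η ζ)).eval (wT (η * ζ)) := by
  let ρ : Polynomial (A3 K) →ₐ[K] Polynomial B :=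
    { toRingHom := (Polynomial.evalRingHom (wT (η * ζ))).comp (Polynomial.mapRingHom (epsA η ζ))
      commutes' := fun a => by
        rw [algQ]
        simp [epsA_k] }
  have hρ : ∀ f, ρ f = (f.map (epsA η ζ)).eval (wT (η * ζ)) := fun f => rfl
  rw [← hρ]
  have hy : ∀ i, ρ (yQ i) = Polynomial.C (b i) * Polynomial.X := by
    intro i
    rw [hρ, hb]
    fin_cases i
    · simp [yQ, epsA_x]
    · simp [yQ, epsA_y]
    · simp [yQ, epsA_z]
    · simp [yQ, wT]
  let m : B →ₗ[K] Polynomial B :=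
    { toFun := fun b => Polynomial.C b * Polynomial.X
      map_add' := fun x y => by rw [map_add, add_mul]
      map_smul' := fun a x => by
        rw [RingHom.id_apply, ← smul_mul_assoc, Polynomial.smul_C] }
  have hL : ρ.toLinearMap ∘ₗ (b.constr K (yQ (K := K))) = m := by
    apply b.ext
    intro i
    rw [LinearMap.comp_apply, Module.Basis.constr_basis]
    exact hy i
  have : piMap (K := K) c = ρ.comp (sigP b c : MvPolynomial (Fin 4) K →ₐ[K] Polynomial (A3 K)) := by
    apply MvPolynomial.algHom_ext
    intro i
    rw [AlgHom.comp_apply]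
    change _ = ρ (sigP b c (X i))
    rw [sigP_X]
    have := congrArg (fun l => l (c i)) hL
    refine Eq.trans ?_ this.symm
    simp [piMap, m]
  rw [this]
  rfl

end SigmaPart

section KerPart
variable {K : Type*} [Field K] {B : Type*} [CommRing B] [Algebra K B]

def pS (s : Polynomial K) : MvPolynomial (Fin 4) K := Polynomial.aeval (X 0) s

def redP (s0 s1 s2 s3 : Polynomial K) : MvPolynomial (Fin 4) K :=
  pS s0 + pS s1 * X 1 + pS s2 * X 2 + pS s3 * X 3

lemma redP_add (s0 s1 s2 s3 t0 t1 t2 t3 : Polynomial K) :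
    redP (s0 + t0) (s1 + t1) (s2 + t2) (s3 + t3) = redP s0 s1 s2 s3 + redP t0 t1 t2 t3 := by
  simp only [redP, pS, map_add]; ring

lemma redP_mul (r s0 s1 s2 s3 : Polynomial K) :
    redP (r * s0) (r * s1) (r * s2) (r * s3) = pS r * redP s0 s1 s2 s3 := by
  simp only [redP, pS, map_mul]; ring

def GoodP (I : Ideal (MvPolynomial (Fin 4) K)) (f : MvPolynomial (Fin 4) K) : Prop :=
  ∃ s0 s1 s2 s3 : Polynomial K, f - redP s0 s1 s2 s3 ∈ I

lemma GoodP.add {I : Ideal (MvPolynomial (Fin 4) K)} {f g} (hf : GoodP I f) (hg : GoodP I g) :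
    GoodP I (f + g) := by
  obtain ⟨s0, s1, s2, s3, h⟩ := hf
  obtain ⟨t0, t1, t2, t3, h'⟩ := hg
  refine ⟨s0 + t0, s1 + t1, s2 + t2, s3 + t3, ?_⟩
  rw [show f + g - redP (s0 + t0) (s1 + t1) (s2 + t2) (s3 + t3) = (f - redP s0 s1 s2 s3) +
    (g - redP t0 t1 t2 t3) by rw [redP_add]; ring]
  exact add_mem h h'

lemma GoodP.mul {I : Ideal (MvPolynomial (Fin 4) K)} {f} (r) (hf : GoodP I f) :
    GoodP I (pS r * f) := by
  obtain ⟨s0, s1, s2, s3, h⟩ := hf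
  refine ⟨r * s0, r * s1, r * s2, r * s3, ?_⟩
  rw [redP_mul, ← mul_sub]
  exact I.mul_mem_left _ h

lemma GoodP.congr {I : Ideal (MvPolynomial (Fin 4) K)} {f g} (hfg : g - f ∈ I) (hf : GoodP I f) :
    GoodP I g := by
  obtain ⟨s0, s1, s2, s3, h⟩ := hf
  refine ⟨s0, s1, s2, s3, ?_⟩
  rw [show g - redP s0 s1 s2 s3 = (g - f) + (f - redP s0 s1 s2 s3) by ring]
  exact add_mem hfg h

lemma pS_X : pS (K := K) Polynomial.X = X 0 := by simp [pS]
lemma pS_C (a : K) : pS (K := K) (Polynomial.C a) = MvPolynomial.C a := by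
  simp [pS, MvPolynomial.algebraMap_eq]
lemma pS_one : pS (K := K) 1 = 1 := by simp [pS]
lemma pS_zero : pS (K := K) 0 = 0 := by simp [pS]

lemma goodP_X (I : Ideal (MvPolynomial (Fin 4) K)) (i : Fin 4) : GoodP I (X i) := by
  fin_cases i
  · exact ⟨Polynomial.X, 0, 0, 0, by simp [redP, pS_X, pS_zero]⟩
  · exact ⟨0, 1, 0, 0, by simp [redP, pS_one, pS_zero]⟩
  · exact ⟨0, 0, 1, 0, by simp [redP, pS_one, pS_zero]⟩
  · exact ⟨0, 0, 0, 1, by simp [redP, pS_one, pS_zero]⟩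

lemma goodP_lin (I : Ideal (MvPolynomial (Fin 4) K)) (l : P1 K) : GoodP I l.1 := by
  induction l using P1_induction with
  | base i => exact goodP_X I i
  | add u v hu hv => exact hu.add hv
  | smul a u hu =>
    have := hu.mul (Polynomial.C a)
    rw [pS_C, ← MvPolynomial.smul_eq_C_mul] at this
    exact this

lemma goodP_all (I : Ideal (MvPolynomial (Fin 4) K))
    (H : ∀ i j, ∃ l ∈ P1 K, X i * X j - X 0 * l ∈ I) (f : MvPolynomial (Fin 4) K) : GoodP I f := by
  have hXX : ∀ i j, GoodP I (X i * X j) := by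
    intro i j
    obtain ⟨l, hl, h⟩ := H i j
    refine GoodP.congr h ?_
    rw [← pS_X]
    exact (goodP_lin I ⟨l, hl⟩).mul _
  induction f using MvPolynomial.induction_on with
  | C a => exact ⟨Polynomial.C a, 0, 0, 0, by simp [redP, pS_C, pS_zero]⟩
  | add p q hp hq => exact hp.add hq
  | mul_X p i hp =>
    obtain ⟨s0, s1, s2, s3, h⟩ := hp
    refine GoodP.congr (f := redP s0 s1 s2 s3 * X i) ?_ ?_
    · rw [← sub_mul]; exact I.mul_mem_right _ h
    · have : redP s0 s1 s2 s3 * X i = pS s0 * X i + pS s1 * (X 1 * X i) + pS s2 * (X 2 * X i) +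
          pS s3 * (X 3 * X i) := by rw [redP]; ring
      rw [this]
      exact ((((goodP_X I i).mul _).add ((hXX 1 i).mul _)).add ((hXX 2 i).mul _)).add
        ((hXX 3 i).mul _)

lemma piMap_X (c : Fin 4 → B) (i : Fin 4) :
    piMap (K := K) c (X i) = Polynomial.C (c i) * Polynomial.X := by simp [piMap]

lemma piMap_pS (c : Fin 4 → B) (hc0 : c 0 = 1) (s : Polynomial K) :
    piMap (K := K) c (pS s) = s.map (algebraMap K B) := by
  have : ((piMap (K := K) c).comp (Polynomial.aeval (X 0))) = Polynomial.mapAlg K B := by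
    apply Polynomial.algHom_ext
    simp [piMap_X, hc0, Polynomial.mapAlg_eq_map]
  have := congrArg (fun g => g s) this
  simpa [Polynomial.mapAlg_eq_map, pS] using this

lemma piMap_redP_coeff (c : Fin 4 → B) (hc0 : c 0 = 1) (s0 s1 s2 s3 : Polynomial K) (n : ℕ) :
    (piMap (K := K) c (redP s0 s1 s2 s3)).coeff n =
      s0.coeff n • c 0 + (Polynomial.X * s1).coeff n • c 1 + (Polynomial.X * s2).coeff n • c 2 +
        (Polynomial.X * s3).coeff n • c 3 := by
  have e : ∀ (s : Polynomial K) (b : B), (s.map (algebraMap K B) * (Polynomial.C b *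
      Polynomial.X)).coeff n = (Polynomial.X * s).coeff n • b := by
    intro s b
    have : s.map (algebraMap K B) * (Polynomial.C b * Polynomial.X) =
        Polynomial.C b * (Polynomial.X * s).map (algebraMap K B) := by
      rw [Polynomial.map_mul, Polynomial.map_X]; ring
    rw [this, Polynomial.coeff_C_mul, Polynomial.coeff_map, Algebra.smul_def, mul_comm]
  simp only [redP, map_add, map_mul, piMap_pS c hc0, piMap_X, Polynomial.coeff_add, e,
    Polynomial.coeff_map]
  rw [hc0, Algebra.smul_def (s0.coeff n), mul_one]

lemma piMap_redP_inj (c : Module.Basis (Fin 4) K B) (hc0 : c 0 = 1) (s0 s1 s2 s3 : Polynomial K)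
    (h : piMap (K := K) c (redP s0 s1 s2 s3) = 0) : redP s0 s1 s2 s3 = 0 := by
  have hli := Fintype.linearIndependent_iff.1 c.linearIndependent
  have hc : ∀ n, s0.coeff n = 0 ∧ (Polynomial.X * s1).coeff n = 0 ∧
      (Polynomial.X * s2).coeff n = 0 ∧ (Polynomial.X * s3).coeff n = 0 := by
    intro n
    have := congrArg (fun p => Polynomial.coeff p n) h
    simp only [piMap_redP_coeff c hc0, Polynomial.coeff_zero] at this
    have := hli ![s0.coeff n, (Polynomial.X * s1).coeff n, (Polynomial.X * s2).coeff n,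
      (Polynomial.X * s3).coeff n] (by simpa [Fin.sum_univ_four] using this)
    exact ⟨this 0, this 1, this 2, this 3⟩
  have z0 : s0 = 0 := by ext n; simpa using (hc n).1
  have z1 : s1 = 0 := by
    have : Polynomial.X * s1 = 0 := by ext n; simpa using (hc n).2.1
    simpa using this
  have z2 : s2 = 0 := by
    have : Polynomial.X * s2 = 0 := by ext n; simpa using (hc n).2.2.1
    simpa using this
  have z3 : s3 = 0 := by
    have : Polynomial.X * s3 = 0 := by ext n; simpa using (hc n).2.2.2
    simpa using this
  rw [z0, z1, z2, z3]
  simp [redP, pS_zero]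

lemma ker_pi_eq (c : Module.Basis (Fin 4) K B) (hc0 : c 0 = 1) (I : Ideal (MvPolynomial (Fin 4) K))
    (hI : I ≤ RingHom.ker (piMap (K := K) c))
    (H : ∀ i j, ∃ l ∈ P1 K, X i * X j - X 0 * l ∈ I) : I = RingHom.ker (piMap (K := K) c) := by
  refine le_antisymm hI fun f hf => ?_
  obtain ⟨s0, s1, s2, s3, h⟩ := goodP_all I H f
  have h1 := hI h
  rw [RingHom.mem_ker, map_sub, RingHom.mem_ker.1 hf, zero_sub, neg_eq_zero] at h1
  rw [piMap_redP_inj c hc0 _ _ _ _ h1, sub_zero] at h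
  exact h

/-- linear form with prescribed coefficients -/
def LP (c : Module.Basis (Fin 4) K B) : B →ₗ[K] MvPolynomial (Fin 4) K := c.constr K (fun i => X i)

lemma piMap_LP (c : Module.Basis (Fin 4) K B) (b : B) :
    piMap (K := K) c (LP c b) = Polynomial.C b * Polynomial.X := by
  let m : B →ₗ[K] Polynomial B :=
    { toFun := fun b => Polynomial.C b * Polynomial.X
      map_add' := fun x y => by rw [map_add, add_mul]
      map_smul' := fun a x => by
        rw [RingHom.id_apply, ← smul_mul_assoc, Polynomial.smul_C] }
  have : (piMap (K := K) c).toLinearMap ∘ₗ LP c = m := by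
    apply c.ext
    intro i
    rw [LinearMap.comp_apply, LP, Module.Basis.constr_basis]
    exact piMap_X c i
  exact congrArg (fun l => l b) this

lemma piMap_coeff_zero (c : Fin 4 → B) (f : MvPolynomial (Fin 4) K) :
    (piMap (K := K) c f).coeff 0 = algebraMap K B (constantCoeff f) := by
  induction f using MvPolynomial.induction_on with
  | C a => simp [piMap]
  | add p q hp hq => simp [hp, hq]
  | mul_X p i hp => simp [piMap_X, Polynomial.mul_coeff_zero]

lemma ann_mem (Φ : MvPolynomial (Fin 4) K →ₗ[K] K) (c : Module.Basis (Fin 4) K B) (hc0 : c 0 = 1)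
    (φ : B →ₗ[K] K) (hnd : ∀ a, (∀ b, φ (a * b) = 0) → a = 0)
    (hΦ : ∀ f, Φ f = φ ((piMap (K := K) c f).coeff 3)) (f : MvPolynomial (Fin 4) K) :
    f ∈ annIdeal K Φ ↔ (piMap (K := K) c f).coeff 0 = 0 ∧ (piMap (K := K) c f).coeff 1 = 0 ∧
      (piMap (K := K) c f).coeff 2 = 0 ∧ φ ((piMap (K := K) c f).coeff 3) = 0 := by
  have hm : f ∈ annIdeal K Φ ↔ ∀ g, Φ (f * g) = 0 := Iff.rfl
  rw [hm]
  constructor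
  · intro h
    have key : ∀ n ≤ 2, (piMap (K := K) c f).coeff n = 0 := by
      intro n hn
      apply hnd
      intro b
      have := h (X 0 ^ (2 - n) * LP c b)
      rw [hΦ, map_mul, map_mul, map_pow, piMap_X, piMap_LP, hc0, map_one, one_mul] at this
      rw [show piMap (K := K) c f * (Polynomial.X ^ (2 - n) * (Polynomial.C b * Polynomial.X)) =
        piMap (K := K) c f * Polynomial.C b * Polynomial.X ^ (2 - n + 1) by ring] at this
      rw [show 3 = n + (2 - n + 1) by omega, Polynomial.coeff_mul_X_pow,
        Polynomial.coeff_mul_C] at this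
      exact this
    refine ⟨key 0 (by norm_num), key 1 (by norm_num), key 2 le_rfl, ?_⟩
    have := h 1
    rwa [mul_one, hΦ] at this
  · rintro ⟨h0, h1, h2, h3⟩ g
    rw [hΦ, map_mul, Polynomial.coeff_mul, Finset.Nat.sum_antidiagonal_eq_sum_range_succ_mk]
    simp [Finset.sum_range_succ, h0, h1, h2, piMap_coeff_zero]
    rw [mul_comm, ← Algebra.smul_def, map_smul, h3, smul_zero]

end KerPart

section NineGens
universe uN
variable {K : Type uN} [Field K] {B : Type uN} [CommRing B] [Algebra K B]

lemma piMap_range (c : Module.Basis (Fin 4) K B) (hc0 : c 0 = 1) (r : Polynomial B) :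
    ∃ f, piMap (K := K) c f = Polynomial.X * r := by
  change Polynomial.X * r ∈ (piMap (K := K) c).range
  rw [r.as_sum_range_C_mul_X_pow, Finset.mul_sum]
  apply sum_mem
  rintro n -
  refine ⟨X 0 ^ n * LP c (r.coeff n), ?_⟩
  change piMap (K := K) c _ = _
  rw [map_mul, map_pow, piMap_X, piMap_LP, hc0]
  simp only [map_one]
  ring

/-- the reduction modulo `x` with grading variable -/
def rhoP : MvPolynomial (Fin 4) K →ₐ[K] Polynomial (MvPolynomial (Fin 4) K) :=
  aeval (fun i => Polynomial.C (if i = 0 then 0 else X i) * Polynomial.X)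

lemma rhoP_X (i : Fin 4) : rhoP (K := K) (X i) =
    Polynomial.C (if i = 0 then 0 else X i) * Polynomial.X := by simp [rhoP]

lemma rhoP_coeff_zero (f : MvPolynomial (Fin 4) K) :
    (rhoP f).coeff 0 = MvPolynomial.C (constantCoeff f) := by
  induction f using MvPolynomial.induction_on with
  | C a => simp [rhoP, MvPolynomial.algebraMap_eq]
  | add p q hp hq => simp [hp, hq]
  | mul_X p i hp => simp only [map_mul, rhoP_X, Polynomial.mul_coeff_zero]; simp

lemma rhoP_coeff_one (c : Module.Basis (Fin 4) K B) (f : MvPolynomial (Fin 4) K) :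
    (rhoP f).coeff 1 = c.constr K (fun i => if i = 0 then 0 else (X i : MvPolynomial (Fin 4) K))
      ((piMap (K := K) c f).coeff 1) := by
  induction f using MvPolynomial.induction_on with
  | C a => simp [rhoP, piMap, Polynomial.algebraMap_apply]
  | add p q hp hq => simp only [map_add, Polynomial.coeff_add, hp, hq]
  | mul_X p i hp =>
    rw [map_mul, map_mul, rhoP_X, piMap_X, ← mul_assoc, ← mul_assoc, Polynomial.coeff_mul_X,
      Polynomial.coeff_mul_X, Polynomial.coeff_mul_C, Polynomial.coeff_mul_C, rhoP_coeff_zero,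
      piMap_coeff_zero, ← Algebra.smul_def, map_smul, Module.Basis.constr_basis,
      MvPolynomial.smul_eq_C_mul]

def LN (c : Fin 4 → B) : MvPolynomial (Fin 4) K →ₗ[K] MvPolynomial (Fin 4) K × B where
  toFun f := ((rhoP f).coeff 2, (piMap (K := K) c f).coeff 3)
  map_add' f g := by simp
  map_smul' a f := by simp

lemma LN_mul (c : Module.Basis (Fin 4) K B) (f h : MvPolynomial (Fin 4) K)
    (h0 : (piMap (K := K) c f).coeff 0 = 0) (h1 : (piMap (K := K) c f).coeff 1 = 0)
    (h2 : (piMap (K := K) c f).coeff 2 = 0) :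
    LN (K := K) c (h * f) = constantCoeff h • LN (K := K) c f := by
  have hnt : Nontrivial B := ⟨⟨c 0, 0, c.ne_zero 0⟩⟩
  have r0 : (rhoP f).coeff 0 = 0 := by
    rw [piMap_coeff_zero, map_eq_zero_iff _ (algebraMap K B).injective] at h0
    rw [rhoP_coeff_zero, h0, map_zero]
  have r1 : (rhoP f).coeff 1 = 0 := by rw [rhoP_coeff_one c, h1, map_zero]
  apply Prod.ext
  · change (rhoP (h * f)).coeff 2 = constantCoeff h • (rhoP f).coeff 2
    rw [map_mul, Polynomial.coeff_mul, Finset.Nat.sum_antidiagonal_eq_sum_range_succ_mk]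
    simp [Finset.sum_range_succ, r0, r1, rhoP_coeff_zero, MvPolynomial.smul_eq_C_mul]
  · change (piMap (K := K) c (h * f)).coeff 3 = constantCoeff h • (piMap (K := K) c f).coeff 3
    rw [map_mul, Polynomial.coeff_mul, Finset.Nat.sum_antidiagonal_eq_sum_range_succ_mk]
    simp [Finset.sum_range_succ, h0, h1, h2, piMap_coeff_zero, Algebra.smul_def]

def sixM : Fin 6 → MvPolynomial (Fin 4) K :=
  ![X 1 * X 1, X 1 * X 2, X 1 * X 3, X 2 * X 2, X 2 * X 3, X 3 * X 3]

def sixE : Fin 6 → (Fin 4 →₀ ℕ) :=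
  ![Finsupp.single 1 1 + Finsupp.single 1 1, Finsupp.single 1 1 + Finsupp.single 2 1,
    Finsupp.single 1 1 + Finsupp.single 3 1, Finsupp.single 2 1 + Finsupp.single 2 1,
    Finsupp.single 2 1 + Finsupp.single 3 1, Finsupp.single 3 1 + Finsupp.single 3 1]

lemma sixE_inj : Function.Injective sixE := by
  apply Function.Injective.of_comp (f := fun m : Fin 4 →₀ ℕ => (m 1, m 2))
  have : (fun m : Fin 4 →₀ ℕ => (m 1, m 2)) ∘ sixE =
      ![(2, 0), (1, 1), (1, 0), (0, 2), (0, 1), (0, 0)] := by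
    funext i
    fin_cases i <;> simp [sixE, Finsupp.single_apply]
  rw [this]
  decide

lemma sixM_li : LinearIndependent K (sixM (K := K)) := by
  have h := (MvPolynomial.basisMonomials (Fin 4) K).linearIndependent.comp sixE sixE_inj
  have e : sixM (K := K) = MvPolynomial.basisMonomials (Fin 4) K ∘ sixE := by
    funext i
    fin_cases i <;> simp [sixM, sixE, MvPolynomial.X, monomial_mul]
  rw [e]
  exact h

theorem nine_gens (Φ : MvPolynomial (Fin 4) K →ₗ[K] K) (c : Module.Basis (Fin 4) K B)
    (hc0 : c 0 = 1) (φ : B →ₗ[K] K) (hnd : ∀ a, (∀ b, φ (a * b) = 0) → a = 0)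
    (hΦ : ∀ f, Φ f = φ ((piMap (K := K) c f).coeff 3)) (v : B) (hv : IsUnit v) (hφv : φ v = 0)
    (u l : Fin 6 → MvPolynomial (Fin 4) K) (hu : ∀ i, u i = sixM i - X 0 * l i)
    (hker : Ideal.span (Set.range u) = RingHom.ker (piMap (K := K) c)) :
    (annIdeal K Φ : Submodule _ _).leastSpanRank = 9 := by
  have hnt : Nontrivial B := ⟨⟨c 0, 0, c.ne_zero 0⟩⟩
  have hφ0 : φ ≠ 0 := by
    rintro rfl
    exact one_ne_zero (hnd 1 (by simp))
  have hfd : FiniteDimensional K B := c.finiteDimensional_of_finite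
  have hker3 : Module.finrank K (LinearMap.ker φ) = 3 := by
    have h1 := LinearMap.finrank_range_add_finrank_ker φ
    rw [LinearMap.range_eq_top.2 (LinearMap.surjective hφ0), finrank_top,
      Module.finrank_self, Module.finrank_eq_card_basis c, Fintype.card_fin] at h1
    omega
  let hb : Module.Basis (Fin 3) K (LinearMap.ker φ) := Module.finBasisOfFinrankEq K _ hker3
  let GG : B → MvPolynomial (Fin 4) K := fun b => X 0 ^ 2 * LP c b
  have hGG : ∀ b, piMap (K := K) c (GG b) = Polynomial.C b * Polynomial.X ^ 3 := by
    intro b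
    simp only [GG, map_mul, map_pow, piMap_X, piMap_LP, hc0, map_one]
    ring
  let G : Fin 3 → MvPolynomial (Fin 4) K := fun j => GG (hb j)
  have hmem := ann_mem Φ c hc0 φ hnd hΦ
  let F : Fin 6 ⊕ Fin 3 → MvPolynomial (Fin 4) K := Sum.elim u G
  have hFann : ∀ i, F i ∈ annIdeal K Φ := by
    rintro (i | j)
    · have : u i ∈ RingHom.ker (piMap (K := K) c) := hker ▸ Ideal.subset_span ⟨i, rfl⟩
      rw [RingHom.mem_ker] at this
      rw [hmem]
      simp only [F, Sum.elim_inl, this]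
      simp
    · rw [hmem]
      simp only [F, Sum.elim_inr, G, hGG]
      have := (hb j).2
      rw [LinearMap.mem_ker] at this
      simp [Polynomial.coeff_X_pow, this]
  have hspan : Ideal.span (Set.range F) = annIdeal K Φ := by
    apply le_antisymm
    · rw [Ideal.span_le]
      rintro _ ⟨i, rfl⟩
      exact hFann i
    · intro f hf
      obtain ⟨f0, f1, f2, f3⟩ := (hmem f).1 hf
      have hGmem : ∀ b ∈ LinearMap.ker φ, GG b ∈ Ideal.span (Set.range F) := by
        intro b hbm
        have hb' : b = ∑ j, hb.repr ⟨b, hbm⟩ j • (hb j : B) := by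
          have := congrArg (LinearMap.ker φ).subtype (hb.sum_repr ⟨b, hbm⟩)
          rw [map_sum] at this
          simp only [map_smul, Submodule.subtype_apply] at this
          exact this.symm
        have : GG b = ∑ j, hb.repr ⟨b, hbm⟩ j • G j := by
          simp only [GG, G]
          conv_lhs => rw [hb', map_sum, Finset.mul_sum]
          simp [map_smul]
        rw [this]
        refine sum_mem fun j _ => ?_
        rw [MvPolynomial.smul_eq_C_mul]
        exact Ideal.mul_mem_left _ _ (Ideal.subset_span ⟨Sum.inr j, rfl⟩)
      have hkm : ∀ g, piMap (K := K) c g = 0 → g ∈ Ideal.span (Set.range F) := by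
        intro g hg
        have : g ∈ Ideal.span (Set.range u) := by rw [hker]; exact hg
        refine Ideal.span_mono ?_ this
        rintro _ ⟨i, rfl⟩
        exact ⟨Sum.inl i, rfl⟩
      have hX4 : Polynomial.X ^ 4 ∣ piMap (K := K) c f - piMap (K := K) c
          (GG ((piMap (K := K) c f).coeff 3)) := by
        rw [Polynomial.X_pow_dvd_iff]
        intro d hd
        rw [hGG]
        interval_cases d <;> simp [Polynomial.coeff_X_pow, f0, f1, f2]
      obtain ⟨r, hr⟩ := hX4
      obtain ⟨w, hw⟩ := hv.exists_right_inv
      obtain ⟨e, he⟩ := piMap_range c hc0 (Polynomial.C w * r)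
      have hz : f - GG ((piMap (K := K) c f).coeff 3) - e * GG v ∈ Ideal.span (Set.range F) := by
        apply hkm
        rw [map_sub, map_sub, hr, map_mul, he, hGG]
        have : (Polynomial.C v * Polynomial.C w : Polynomial B) = 1 := by rw [← map_mul, hw, map_one]
        linear_combination (-(Polynomial.X ^ 4 * r)) * this
      have := add_mem (add_mem hz (Ideal.mul_mem_left _ e (hGmem v hφv))) (hGmem _ f3)
      rwa [sub_add_cancel, sub_add_cancel] at this
  apply le_antisymm
  · refine (ciInf_le' _ (⟨Set.range F, hspan⟩ : {s : Set (MvPolynomial (Fin 4) K) //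
      Submodule.span _ s = annIdeal K Φ})).trans ?_
    have := Cardinal.mk_range_le_lift (f := F)
    simp at this
    refine this.trans ?_
    norm_num
  · haveI : Nonempty {s : Set (MvPolynomial (Fin 4) K) // Submodule.span _ s = annIdeal K Φ} :=
      ⟨⟨Set.range F, hspan⟩⟩
    refine le_ciInf ?_
    rintro ⟨s, hs⟩
    have key : ∀ f ∈ annIdeal K Φ, LN (K := K) c f ∈ Submodule.span K (LN (K := K) c '' s) := by
      intro f hf
      rw [← hs] at hf
      induction hf using Submodule.span_induction with
      | mem x hx => exact Submodule.subset_span ⟨x, hx, rfl⟩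
      | zero => rw [map_zero]; exact zero_mem _
      | add x y _ _ hx hy => rw [map_add]; exact add_mem hx hy
      | smul h x hx hx' =>
        rw [hs] at hx
        obtain ⟨f0, f1, f2, f3⟩ := (hmem x).1 hx
        rw [smul_eq_mul, LN_mul c x h f0 f1 f2]
        exact Submodule.smul_mem _ _ hx'
    let W : Fin 6 ⊕ Fin 3 → MvPolynomial (Fin 4) K × B :=
      Sum.elim (LinearMap.inl K _ _ ∘ sixM) (LinearMap.inr K _ _ ∘ fun j => (hb j : B))
    have hW : LinearIndependent K W := by
      apply linearIndependent_inl_union_inr' sixM_li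
      exact hb.linearIndependent.map' (LinearMap.ker φ).subtype (Submodule.ker_subtype _)
    have hWL : ∀ i, LN (K := K) c (F i) = W i := by
      rintro (i | j)
      · have : u i ∈ RingHom.ker (piMap (K := K) c) := hker ▸ Ideal.subset_span ⟨i, rfl⟩
        rw [RingHom.mem_ker] at this
        apply Prod.ext
        · change (rhoP (u i)).coeff 2 = sixM i
          rw [hu, map_sub, map_mul, rhoP_X]
          fin_cases i <;> simp [sixM, rhoP_X, ← mul_assoc, Polynomial.coeff_X, Polynomial.coeff_C]
        · change (piMap (K := K) c (u i)).coeff 3 = 0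
          rw [this, Polynomial.coeff_zero]
      · apply Prod.ext
        · change (rhoP (GG (hb j))).coeff 2 = 0
          simp [GG, rhoP_X]
        · change (piMap (K := K) c (GG (hb j))).coeff 3 = hb j
          rw [hGG]; simp [Polynomial.coeff_X_pow]
    have hle : Submodule.span K (Set.range W) ≤ Submodule.span K (LN (K := K) c '' s) := by
      rw [Submodule.span_le]
      rintro _ ⟨i, rfl⟩
      rw [← hWL]
      exact key _ (hFann i)
    have h9 : (9 : Cardinal) = Module.rank K (Submodule.span K (Set.range W)) := by
      rw [rank_span hW]
      have := Cardinal.mk_range_eq_of_injective hW.injective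
      simp at this
      rw [← this]
    rw [h9]
    exact (Submodule.rank_mono hle).trans ((rank_span_le _).trans Cardinal.mk_image_le)

end NineGens

section ResPart

lemma res_conv {R : Type*} [CommRing R] [Nontrivial R] {F1 F2 F3 : Type*}
    [AddCommGroup F1] [Module R F1] [Module.Free R F1] [Module.Finite R F1]
    [AddCommGroup F2] [Module R F2] [Module.Free R F2] [Module.Finite R F2]
    [AddCommGroup F3] [Module R F3] [Module.Free R F3] [Module.Finite R F3]
    (d3 : F3 →ₗ[R] F2) (d2 : F2 →ₗ[R] F1) (d1 : F1 →ₗ[R] R) (I : Ideal R)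
    (h3 : ∀ f, d3 f = 0 → f = 0) (h32 : ∀ f, d2 (d3 f) = 0)
    (h2 : ∀ f, d2 f = 0 → ∃ g, d3 g = f) (h21 : ∀ f, d1 (d2 f) = 0)
    (h1 : ∀ f, d1 f = 0 → ∃ g, d2 g = f) (hI : ∀ g, g ∈ I ↔ ∃ f, d1 f = g) :
    HasLengthThreeFreeResolution I := by
  let e1 := (Module.finBasis R F1).equivFun
  let e2 := (Module.finBasis R F2).equivFun
  let e3 := (Module.finBasis R F3).equivFun
  refine ⟨_, _, _, e2.toLinearMap ∘ₗ d3 ∘ₗ e3.symm.toLinearMap,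
    e1.toLinearMap ∘ₗ d2 ∘ₗ e2.symm.toLinearMap, d1 ∘ₗ e1.symm.toLinearMap, ?_, ?_, ?_, ?_⟩
  · rw [← LinearMap.ker_eq_bot, LinearMap.ker_eq_bot']
    intro f hf
    have h : d3 (e3.symm f) = 0 := by
      simpa using hf
    have := h3 _ h
    simpa using this
  · ext f
    constructor
    · rintro ⟨g, rfl⟩
      simp [h32]
    · intro hf
      have h : d2 (e2.symm f) = 0 := by simpa using hf
      obtain ⟨g, hg⟩ := h2 _ h
      exact ⟨e3 g, by simp [hg]⟩
  · ext f
    constructor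
    · rintro ⟨g, rfl⟩
      simp [h21]
    · intro hf
      have h : d1 (e1.symm f) = 0 := by simpa using hf
      obtain ⟨g, hg⟩ := h1 _ h
      exact ⟨e2 g, by simp [hg]⟩
  · ext g
    rw [hI]
    constructor
    · rintro ⟨f, rfl⟩
      exact ⟨e1.symm f, by simp⟩
    · rintro ⟨f, rfl⟩
      exact ⟨e1 f, by simp⟩

section
variable {R N : Type*} [CommRing R] [CommRing N] [Algebra R N]

def kz1 (R : Type*) {N : Type*} [CommRing R] [CommRing N] [Algebra R N] (a b c : N) :
    N × N × N →ₗ[R] N where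
  toFun n := a * n.1 + b * n.2.1 + c * n.2.2
  map_add' n m := by simp only [Prod.fst_add, Prod.snd_add]; ring
  map_smul' r n := by simp [smul_add, mul_smul_comm]

def kz2 (R : Type*) {N : Type*} [CommRing R] [CommRing N] [Algebra R N] (a b c : N) :
    N × N × N →ₗ[R] N × N × N where
  toFun m := (b * m.2.2 - c * m.2.1, c * m.1 - a * m.2.2, a * m.2.1 - b * m.1)
  map_add' n m := by
    simp only [Prod.fst_add, Prod.snd_add, Prod.mk_add_mk]
    refine Prod.ext ?_ (Prod.ext ?_ ?_) <;> simp only <;> ring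
  map_smul' r n := by simp [smul_sub, mul_smul_comm]

def kz3 (R : Type*) {N : Type*} [CommRing R] [CommRing N] [Algebra R N] (a b c : N) :
    N →ₗ[R] N × N × N where
  toFun n := (a * n, b * n, c * n)
  map_add' n m := by simp [mul_add]
  map_smul' r n := by simp [mul_smul_comm]

lemma mem_span3 (a b c f : N) : f ∈ Ideal.span {a, b, c} ↔ ∃ n, kz1 R a b c n = f := by
  rw [Ideal.mem_span_insert]
  constructor
  · rintro ⟨p, z, hz, rfl⟩
    obtain ⟨q, r, rfl⟩ := Ideal.mem_span_pair.mp hz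
    exact ⟨(p, q, r), by simp only [kz1, LinearMap.coe_mk, AddHom.coe_mk]; ring⟩
  · rintro ⟨⟨p, q, r⟩, rfl⟩
    refine ⟨p, q * b + r * c, Ideal.mem_span_pair.mpr ⟨q, r, rfl⟩, ?_⟩
    simp only [kz1, LinearMap.coe_mk, AddHom.coe_mk]; ring

lemma kz_exact1 (a b c : N) (h1 : ∀ f, a * f = 0 → f = 0)
    (h2 : ∀ f, b * f ∈ Ideal.span {a} → f ∈ Ideal.span {a})
    (h3 : ∀ f, c * f ∈ Ideal.span {a, b} → f ∈ Ideal.span {a, b}) (n : N × N × N)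
    (hn : kz1 R a b c n = 0) : ∃ m, kz2 R a b c m = n := by
  obtain ⟨n1, n2, n3⟩ := n
  simp only [kz1, LinearMap.coe_mk, AddHom.coe_mk] at hn
  obtain ⟨p, q, hpq⟩ := Ideal.mem_span_pair.mp (h3 n3 (Ideal.mem_span_pair.mpr
    ⟨-n1, -n2, by linear_combination -hn⟩))
  obtain ⟨r, hr⟩ := Ideal.mem_span_singleton'.mp (h2 (n2 + c * q)
    (Ideal.mem_span_singleton'.mpr ⟨-(n1 + c * p), by linear_combination -hn - c * hpq⟩))
  have h := h1 (n1 + c * p + b * r) (by linear_combination hn + c * hpq + b * hr)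
  refine ⟨(-q, p, -r), ?_⟩
  simp only [kz2, LinearMap.coe_mk, AddHom.coe_mk]
  refine Prod.ext ?_ (Prod.ext ?_ ?_) <;> simp only
  · linear_combination -h
  · linear_combination hr
  · linear_combination hpq

lemma kz_exact2 (a b c : N) (h1 : ∀ f, a * f = 0 → f = 0)
    (h2 : ∀ f, b * f ∈ Ideal.span {a} → f ∈ Ideal.span {a}) (m : N × N × N)
    (hm : kz2 R a b c m = 0) : ∃ n, kz3 R a b c n = m := by
  obtain ⟨m1, m2, m3⟩ := m
  simp only [kz2, LinearMap.coe_mk, AddHom.coe_mk, Prod.ext_iff, Prod.fst_zero, Prod.snd_zero] at hm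
  obtain ⟨e1, e2, e3⟩ := hm
  obtain ⟨t, ht⟩ := Ideal.mem_span_singleton'.mp (h2 m1
    (Ideal.mem_span_singleton'.mpr ⟨m2, by linear_combination e3⟩))
  refine ⟨t, ?_⟩
  simp only [kz3, LinearMap.coe_mk, AddHom.coe_mk]
  refine Prod.ext ?_ (Prod.ext ?_ ?_) <;> simp only
  · linear_combination ht
  · exact (sub_eq_zero.mp (h1 (m2 - b * t) (by linear_combination e3 - b * ht))).symm
  · exact (sub_eq_zero.mp (h1 (m3 - c * t) (by linear_combination -e2 - c * ht))).symm

theorem res_of_koszul [Nontrivial R] [Module.Free R N] [Module.Finite R N]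
    (a b c : N) (h1 : ∀ f, a * f = 0 → f = 0)
    (h2 : ∀ f, b * f ∈ Ideal.span {a} → f ∈ Ideal.span {a})
    (h3 : ∀ f, c * f ∈ Ideal.span {a, b} → f ∈ Ideal.span {a, b}) (I : Ideal R)
    (hI : ∀ g, g ∈ I ↔ algebraMap R N g ∈ Ideal.span {a, b, c})
    (hs : ∀ f : N, ∃ r : R, f - algebraMap R N r ∈ Ideal.span {a, b, c}) :
    HasLengthThreeFreeResolution I := by
  have hs' : ∀ f : N, ∃ (r : R) (n : N × N × N), kz1 R a b c n = f - algebraMap R N r := by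
    intro f
    obtain ⟨r, hr⟩ := hs f
    exact ⟨r, (mem_span3 (R := R) _ _ _ _).mp hr⟩
  choose r n hrn using hs'
  let e := Module.Free.chooseBasis R N
  let β : N →ₗ[R] R := e.constr R (fun j => r (e j))
  let L : N →ₗ[R] N × N × N := e.constr R (fun j => n (e j))
  have hL : ∀ f, kz1 R a b c (L f) = f - β f • (1 : N) := by
    have : (kz1 R a b c) ∘ₗ L = LinearMap.id - β.smulRight (1 : N) := by
      apply e.ext
      intro j
      simp [L, β, hrn, Algebra.algebraMap_eq_smul_one]
    intro f
    exact LinearMap.congr_fun this f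
  have h12 : ∀ m, kz1 R a b c (kz2 R a b c m) = 0 := by
    intro m
    simp only [kz1, kz2, LinearMap.coe_mk, AddHom.coe_mk]; ring
  have h23 : ∀ m, kz2 R a b c (kz3 R a b c m) = 0 := by
    intro m
    simp only [kz2, kz3, LinearMap.coe_mk, AddHom.coe_mk]
    refine Prod.ext ?_ (Prod.ext ?_ ?_) <;> simp only [Prod.fst_zero, Prod.snd_zero] <;> ring
  let d1 : (N × N × N) × R →ₗ[R] R :=
    LinearMap.snd R _ R - β ∘ₗ ((kz1 R a b c) ∘ₗ LinearMap.fst R _ _ +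
      (LinearMap.snd R _ R).smulRight (1 : N))
  have hd1 : ∀ n g, d1 (n, g) = g - β (kz1 R a b c n + g • 1) := by
    intro n g; simp [d1]
  let d2 : (N × N × N) × N →ₗ[R] (N × N × N) × R :=
    LinearMap.prod ((kz2 R a b c) ∘ₗ LinearMap.fst R _ _ + L ∘ₗ LinearMap.snd R _ _)
      (β ∘ₗ LinearMap.snd R _ _)
  have hd2 : ∀ m f, d2 (m, f) = (kz2 R a b c m + L f, β f) := by
    intro n g; simp [d2]
  let d3 : N →ₗ[R] (N × N × N) × N := LinearMap.inl R _ _ ∘ₗ kz3 R a b c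
  have hd3 : ∀ n, d3 n = (kz3 R a b c n, 0) := by
    intro n; simp [d3]
  refine res_conv d3 d2 d1 I ?_ ?_ ?_ ?_ ?_ ?_
  · intro f hf
    rw [hd3] at hf
    have := congrArg (fun t => t.1.1) hf
    exact h1 f (by simpa [kz3] using this)
  · intro f
    rw [hd3, hd2, h23]; simp
  · rintro ⟨m, f⟩ hf
    rw [hd2] at hf
    have e1 := congrArg Prod.fst hf
    have e2 := congrArg Prod.snd hf
    simp only [Prod.fst_zero, Prod.snd_zero] at e1 e2
    have e3 := congrArg (kz1 R a b c) e1
    rw [map_add, h12, hL, e2, map_zero] at e3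
    have hf0 : f = 0 := by simpa using e3
    subst hf0
    obtain ⟨t, ht⟩ := kz_exact2 (R := R) a b c h1 h2 m (by simpa using e1)
    exact ⟨t, by rw [hd3, ht]⟩
  · rintro ⟨m, f⟩
    rw [hd2, hd1, map_add (kz1 R a b c), h12, hL]
    simp
  · rintro ⟨m, g⟩ hf
    rw [hd1] at hf
    set f := kz1 R a b c m + g • (1 : N) with hfd
    have hg : β f = g := (sub_eq_zero.mp hf).symm
    obtain ⟨t, ht⟩ := kz_exact1 (R := R) a b c h1 h2 h3 (m - L f) (by
      rw [map_sub, hL, hg, hfd]; simp)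
    exact ⟨(t, f), by rw [hd2, ht, hg]; simp⟩
  · intro g
    rw [hI]
    constructor
    · intro hg
      obtain ⟨m, hm⟩ := (mem_span3 (R := R) _ _ _ _).mp hg
      refine ⟨(-m, g), ?_⟩
      rw [hd1, map_neg, hm, Algebra.algebraMap_eq_smul_one]
      simp
    · rintro ⟨⟨m, g'⟩, rfl⟩
      refine (mem_span3 (R := R) _ _ _ _).mpr ⟨-m + L (kz1 R a b c m + g' • (1 : N)), ?_⟩
      rw [map_add, hL, map_neg, hd1, Algebra.algebraMap_eq_smul_one, sub_smul]
      abel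
end
end ResPart

section ResPart2

lemma mv_reg {M : Type*} [CommRing M] {n : Type*} (s : Set n) (j : n) (hj : j ∉ s)
    (f : MvPolynomial n M)
    (h : X j * f ∈ Ideal.span ((fun i => (X i : MvPolynomial n M)) '' s)) :
    f ∈ Ideal.span ((fun i => (X i : MvPolynomial n M)) '' s) := by
  classical
  rw [MvPolynomial.mem_ideal_span_X_image] at h ⊢
  intro m hm
  obtain ⟨i, his, hi⟩ := h (m + Finsupp.single j 1) (by
    rw [MvPolynomial.mem_support_iff] at hm ⊢
    rw [mul_comm, MvPolynomial.coeff_mul_X]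
    exact hm)
  refine ⟨i, his, ?_⟩
  have hij : j ≠ i := by rintro rfl; exact hj his
  simpa [Finsupp.single_apply, hij] using hi

def shiftM {M : Type*} [CommRing M] {n : Type*} (m : n → M) : MvPolynomial n M →ₐ[M] MvPolynomial n M :=
  MvPolynomial.aeval (fun i => X i - MvPolynomial.C (m i))

def shiftE {M : Type*} [CommRing M] {n : Type*} (m : n → M) : MvPolynomial n M ≃ₐ[M] MvPolynomial n M :=
  AlgEquiv.ofAlgHom (shiftM m) (shiftM (-m))
    (by ext i; simp [shiftM, MvPolynomial.algebraMap_eq])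
    (by ext i; simp [shiftM, MvPolynomial.algebraMap_eq])

lemma shiftE_X {M : Type*} [CommRing M] {n : Type*} (m : n → M) (i : n) :
    shiftE m (X i) = X i - MvPolynomial.C (m i) := by
  simp [shiftE, shiftM]

lemma shift_mem {M : Type*} [CommRing M] {n : Type*} (m : n → M) (s : Set (MvPolynomial n M))
    (f : MvPolynomial n M) :
    f ∈ Ideal.span (shiftE m '' s) ↔ (shiftE m).symm f ∈ Ideal.span s := by
  have : Ideal.span (shiftE m '' s) = (Ideal.span s).map (shiftE m) := (Ideal.map_span _ _).symm
  rw [this]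
  constructor
  · intro h
    obtain ⟨g, hg, rfl⟩ := (Ideal.mem_map_of_equiv (shiftE m) f).mp h
    simpa using hg
  · intro h
    have := Ideal.mem_map_of_mem (shiftE m) h
    simpa using this

lemma shift_reg {M : Type*} [CommRing M] {n : Type*} (m : n → M) (s : Set n) (j : n) (hj : j ∉ s)
    (f : MvPolynomial n M)
    (h : (X j - MvPolynomial.C (m j)) * f ∈ Ideal.span ((fun i => (X i - MvPolynomial.C (m i))) '' s)) :
    f ∈ Ideal.span ((fun i => (X i - MvPolynomial.C (m i))) '' s) := by
  have e : ((fun i => (X i - MvPolynomial.C (m i))) '' s) =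
      shiftE m '' ((fun i => (X i : MvPolynomial n M)) '' s) := by
    rw [Set.image_image]; simp [shiftE_X]
  rw [e, shift_mem] at h ⊢
  rw [map_mul, ← shiftE_X, AlgEquiv.symm_apply_apply] at h
  exact mv_reg s j hj _ h

lemma shift_eval {M : Type*} [CommRing M] (m : Fin 3 → M) (f : MvPolynomial (Fin 3) M) :
    f ∈ Ideal.span {X 0 - MvPolynomial.C (m 0), X 1 - MvPolynomial.C (m 1), X 2 - MvPolynomial.C (m 2)} ↔
      MvPolynomial.eval m f = 0 := by
  set J : Ideal (MvPolynomial (Fin 3) M) := Ideal.span {X 0 - MvPolynomial.C (m 0), X 1 - MvPolynomial.C (m 1), X 2 - MvPolynomial.C (m 2)} with hJ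
  have h1 : ∀ f, f - MvPolynomial.C (MvPolynomial.eval m f) ∈ J := by
    intro f
    rw [← Ideal.Quotient.eq]
    have : (Ideal.Quotient.mk J) =
      ((Ideal.Quotient.mk J).comp MvPolynomial.C).comp (MvPolynomial.eval m) := by
      apply MvPolynomial.ringHom_ext
      · intro a; simp
      · intro i
        simp only [RingHom.comp_apply, MvPolynomial.eval_X]
        rw [Ideal.Quotient.eq]
        apply Ideal.subset_span
        fin_cases i <;> simp
    exact RingHom.congr_fun this f
  constructor
  · intro h
    have : J ≤ RingHom.ker (MvPolynomial.eval m) := by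
      rw [hJ, Ideal.span_le]
      rintro x (rfl | rfl | rfl) <;> simp [RingHom.mem_ker]
    exact this h
  · intro h
    have := h1 f
    rw [h] at this
    simpa using this

section
attribute [local instance] MvPolynomial.algebraMvPolynomial
lemma mv_basis (S M : Type*) [CommRing S] [CommRing M] [Algebra S M] [Module.Free S M]
    [Module.Finite S M] : ∃ (ι : Type) (_ : Finite ι),
      Nonempty (Module.Basis ι (MvPolynomial (Fin 3) S) (MvPolynomial (Fin 3) M)) := by
  cases subsingleton_or_nontrivial S with
  | inl h =>
    have : Subsingleton (MvPolynomial (Fin 3) S) := inferInstance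
    have : Subsingleton (MvPolynomial (Fin 3) M) := Module.subsingleton (MvPolynomial (Fin 3) S) _
    exact ⟨Empty, inferInstance, ⟨Module.Basis.empty _⟩⟩
  | inr h =>
  have hp : Algebra.IsPushout S (MvPolynomial (Fin 3) S) M (MvPolynomial (Fin 3) M) := inferInstance
  exact ⟨_, inferInstance, ⟨((Module.finBasis S M).baseChange (MvPolynomial (Fin 3) S)).map hp.out.equiv⟩⟩

variable {K : Type*} [Field K]

def eP : MvPolynomial (Fin 4) K ≃ₐ[K] MvPolynomial (Fin 3) (Polynomial K) :=
  (MvPolynomial.renameEquiv K (_root_.finSuccEquiv 3)).trans (MvPolynomial.optionEquivRight K (Fin 3))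

lemma eP_zero : eP (K := K) (X 0) = MvPolynomial.C Polynomial.X := by
  simp [eP, MvPolynomial.renameEquiv_apply, MvPolynomial.optionEquivRight_X_none]

lemma eP_succ (i : Fin 3) : eP (K := K) (X i.succ) = X i := by
  simp [eP, MvPolynomial.renameEquiv_apply, MvPolynomial.optionEquivRight_X_some]

lemma eP_C (a : K) : eP (K := K) (MvPolynomial.C a) = MvPolynomial.C (Polynomial.C a) := by
  simp [eP, MvPolynomial.renameEquiv_apply, MvPolynomial.optionEquivRight_C]

theorem res_of_free (M : Type*) [CommRing M] [Algebra (Polynomial K) M] [Module.Free (Polynomial K) M]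
    [Module.Finite (Polynomial K) M] (χ : MvPolynomial (Fin 4) K →+* M)
    (hχ : Function.Surjective χ) (hS : ∀ s, χ (pS s) = algebraMap (Polynomial K) M s) :
    HasLengthThreeFreeResolution (RingHom.ker χ) := by
  obtain ⟨ι, hι, ⟨bb⟩⟩ := mv_basis (Polynomial K) M
  let θ : MvPolynomial (Fin 4) K →+* MvPolynomial (Fin 3) M :=
    (MvPolynomial.map (algebraMap (Polynomial K) M)).comp (eP (K := K) : _ →+* _)
  letI : Algebra (MvPolynomial (Fin 4) K) (MvPolynomial (Fin 3) M) := θ.toAlgebra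
  let b2 := bb.mapCoeffs (eP (K := K)).symm.toRingEquiv (by
    intro c x
    rw [Algebra.smul_def, Algebra.smul_def]
    congr 1
    change MvPolynomial.map _ (eP (eP.symm c)) = MvPolynomial.map _ c
    rw [AlgEquiv.apply_symm_apply])
  haveI : Module.Free (MvPolynomial (Fin 4) K) (MvPolynomial (Fin 3) M) := Module.Free.of_basis b2
  haveI : Module.Finite (MvPolynomial (Fin 4) K) (MvPolynomial (Fin 3) M) := Module.Finite.of_basis b2
  let m : Fin 3 → M := fun i => χ (X i.succ)
  have hev : ∀ g, MvPolynomial.eval m (θ g) = χ g := by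
    intro g
    have : (MvPolynomial.eval m).comp θ = χ := by
      apply MvPolynomial.ringHom_ext
      · intro a
        have := hS (Polynomial.C a)
        rw [pS_C] at this
        simp [θ, eP_C, this]
      · intro i
        refine Fin.cases ?_ (fun j => ?_) i
        · have := hS Polynomial.X
          rw [pS_X] at this
          simp [θ, eP_zero, this]
        · simp [θ, eP_succ, m]
    exact RingHom.congr_fun this g
  have key : ∀ s : Set (Fin 3), ∀ j ∉ s, _ := fun s j hj => shift_reg m s j hj
  refine res_of_koszul (R := MvPolynomial (Fin 4) K) (N := MvPolynomial (Fin 3) M)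
    (X 0 - MvPolynomial.C (m 0)) (X 1 - MvPolynomial.C (m 1)) (X 2 - MvPolynomial.C (m 2)) ?_ ?_ ?_ _ ?_ ?_
  · intro f hf
    have := key ∅ 0 (by simp) f (by rw [hf]; simp)
    simpa using this
  · intro f hf
    have := key {0} 1 (by simp) f (by simpa using hf)
    simpa using this
  · intro f hf
    have := key {0, 1} 2 (by simp) f (by simpa [Set.image_pair] using hf)
    simpa [Set.image_pair] using this
  · intro g
    rw [shift_eval, RingHom.mem_ker]
    change _ ↔ MvPolynomial.eval m (θ g) = 0
    rw [hev]
  · intro f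
    obtain ⟨r, hr⟩ := hχ (MvPolynomial.eval m f)
    refine ⟨r, ?_⟩
    rw [shift_eval, map_sub]
    change _ - MvPolynomial.eval m (θ r) = 0
    rw [hev, hr, sub_self]
end
end ResPart2

section ResPart3
open scoped Polynomial
variable {K : Type*} [Field K] {B : Type*} [CommRing B] [Algebra K B]

def pSHom : Polynomial K →+* MvPolynomial (Fin 4) K := (Polynomial.aeval (X 0)).toRingHom

lemma pSHom_apply (s : Polynomial K) : pSHom s = pS s := rfl

theorem res_of_ideal (I : Ideal (MvPolynomial (Fin 4) K))
    (hint : ∀ f, ∃ p : Polynomial (Polynomial K), p.Monic ∧ p.eval₂ pSHom f ∈ I)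
    (htf : ∀ s : Polynomial K, s ≠ 0 → ∀ f, pS s * f ∈ I → f ∈ I) :
    HasLengthThreeFreeResolution I := by
  letI : Algebra (Polynomial K) (MvPolynomial (Fin 4) K ⧸ I) :=
    ((Ideal.Quotient.mk I).comp pSHom).toAlgebra
  have halg : ∀ s, algebraMap (Polynomial K) (MvPolynomial (Fin 4) K ⧸ I) s =
    Ideal.Quotient.mk I (pS s) := fun s => rfl
  haveI h1 : Algebra.IsIntegral (Polynomial K) (MvPolynomial (Fin 4) K ⧸ I) := by
    constructor
    intro x
    obtain ⟨f, rfl⟩ := Ideal.Quotient.mk_surjective x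
    obtain ⟨p, hp, hf⟩ := hint f
    refine ⟨p, hp, ?_⟩
    change p.eval₂ ((Ideal.Quotient.mk I).comp pSHom) (Ideal.Quotient.mk I f) = 0
    rw [← Polynomial.hom_eval₂]
    exact Ideal.Quotient.eq_zero_iff_mem.mpr hf
  haveI h2 : Algebra.FiniteType (Polynomial K) (MvPolynomial (Fin 4) K ⧸ I) := by
    have hh : ((Ideal.Quotient.mk I).comp pSHom : Polynomial K →+* _).FiniteType := by
      apply RingHom.FiniteType.of_comp_finiteType (f := (Polynomial.C : K →+* Polynomial K))
      have e : ((Ideal.Quotient.mk I).comp pSHom).comp Polynomial.C =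
          (Ideal.Quotient.mk I).comp (MvPolynomial.C : K →+* MvPolynomial (Fin 4) K) := by
        ext a
        change Ideal.Quotient.mk I (pS (Polynomial.C a)) = _
        rw [pS_C]; rfl
      rw [e]
      apply RingHom.FiniteType.comp
      · exact RingHom.FiniteType.of_surjective _ Ideal.Quotient.mk_surjective
      · have : Algebra.FiniteType K (MvPolynomial (Fin 4) K) := inferInstance
        rw [← MvPolynomial.algebraMap_eq, RingHom.finiteType_algebraMap]
        exact this
    exact hh
  haveI h3 : Module.Finite (Polynomial K) (MvPolynomial (Fin 4) K ⧸ I) := Algebra.IsIntegral.finite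
  haveI h4 : Module.IsTorsionFree (Polynomial K) (MvPolynomial (Fin 4) K ⧸ I) := by
    apply Module.IsTorsionFree.of_smul_eq_zero
    intro s x hsx
    obtain ⟨f, rfl⟩ := Ideal.Quotient.mk_surjective x
    by_cases hs : s = 0
    · exact Or.inl hs
    · right
      rw [Algebra.smul_def, halg, ← map_mul, Ideal.Quotient.eq_zero_iff_mem] at hsx
      exact Ideal.Quotient.eq_zero_iff_mem.mpr (htf s hs f hsx)
  have := res_of_free (MvPolynomial (Fin 4) K ⧸ I) (Ideal.Quotient.mk I)
    Ideal.Quotient.mk_surjective (fun s => rfl)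
  rwa [Ideal.mk_ker] at this

lemma map_cancel [Nontrivial B] (s : Polynomial K) (hs : s ≠ 0) (q : B[X])
    (h : s.map (algebraMap K B) * q = 0) : q = 0 := by
  by_contra hq
  have hu : IsUnit (s.map (algebraMap K B)).leadingCoeff := by
    rw [Polynomial.leadingCoeff_map]
    exact (isUnit_iff_ne_zero.mpr (Polynomial.leadingCoeff_ne_zero.mpr hs)).map _
  have h2 : (s.map (algebraMap K B)).leadingCoeff * q.leadingCoeff ≠ 0 := by
    rw [Ne, hu.mul_right_eq_zero]
    exact Polynomial.leadingCoeff_ne_zero.mpr hq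
  have := Polynomial.leadingCoeff_mul' h2
  rw [h, Polynomial.leadingCoeff_zero] at this
  exact h2 this.symm

lemma map_integral [Module.Finite K B] :
    (Polynomial.mapRingHom (algebraMap K B)).IsIntegral := by
  intro f
  induction f using Polynomial.induction_on' with
  | add p q hp hq => exact RingHom.IsIntegralElem.add _ hp hq
  | monomial n b =>
    rw [← Polynomial.C_mul_X_pow_eq_monomial]
    apply RingHom.IsIntegralElem.mul
    · obtain ⟨p, hp, hb⟩ := Algebra.IsIntegral.isIntegral (R := K) b
      refine ⟨p.map Polynomial.C, hp.map _, ?_⟩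
      rw [Polynomial.eval₂_map]
      have : (Polynomial.mapRingHom (algebraMap K B)).comp Polynomial.C =
        Polynomial.C.comp (algebraMap K B) := by ext a; simp
      rw [this, ← Polynomial.hom_eval₂, hb, map_zero]
    · have : (Polynomial.X ^ n : B[X]) = Polynomial.mapRingHom (algebraMap K B) (Polynomial.X ^ n) := by
        simp
      rw [this]
      exact RingHom.isIntegralElem_map _

section
variable (Ψ : MvPolynomial (Fin 4) K →+* B[X][X])
  (hΨ : ∀ s, Ψ (pS s) = Polynomial.C (s.map (algebraMap K B))) (q : B[X][X]) (hq : q.Monic)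
  (a : Ideal (MvPolynomial (Fin 4) K)) (ha : ∀ f, f ∈ a ↔ Ψ f %ₘ q = 0)
include hΨ hq ha

lemma link_tf [Nontrivial B] (s : Polynomial K) (hs : s ≠ 0) (f) (h : pS s * f ∈ a) : f ∈ a := by
  rw [ha, map_mul, hΨ, ← Polynomial.smul_eq_C_mul, Polynomial.smul_modByMonic] at h
  rw [ha]
  ext1 n
  have := congrArg (fun t => Polynomial.coeff t n) h
  simp only [Polynomial.coeff_smul, smul_eq_mul, Polynomial.coeff_zero] at this
  exact map_cancel s hs _ this

lemma link_int [Module.Finite K B] (f) :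
    ∃ p : Polynomial (Polynomial K), p.Monic ∧ p.eval₂ pSHom f ∈ a := by
  have h1 := hq.quotient_isIntegral (I := Ideal.span {q}) (Ideal.mem_span_singleton_self q)
  have h2 := RingHom.IsIntegral.trans _ _ (map_integral (K := K) (B := B)) h1
  obtain ⟨p, hp, h⟩ := h2 (Ideal.Quotient.mk (Ideal.span {q}) (Ψ f))
  refine ⟨p, hp, ?_⟩
  rw [ha, Polynomial.modByMonic_eq_zero_iff_dvd hq, ← Ideal.mem_span_singleton,
    ← Ideal.Quotient.eq_zero_iff_mem, Polynomial.hom_eval₂, Polynomial.hom_eval₂]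
  refine Eq.trans (congrArg (fun r => Polynomial.eval₂ r _ p) (RingHom.ext fun s => ?_)) h
  change Ideal.Quotient.mk _ (Ψ (pS s)) = _
  rw [hΨ]
  rfl

theorem res_of_link [Module.Finite K B] (I : Ideal (MvPolynomial (Fin 4) K)) (haI : a ≤ I)
    (htf : ∀ s : Polynomial K, s ≠ 0 → ∀ f, pS s * f ∈ I → f ∈ I) :
    HasLengthThreeFreeResolution I := by
  refine res_of_ideal I (fun f => ?_) htf
  obtain ⟨p, hp, h⟩ := link_int Ψ hΨ q hq a ha f
  exact ⟨p, hp, haI h⟩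
end
end ResPart3

section FinalPart
set_option maxSynthPendingDepth 6

lemma psi_pS {K : Type*} [Field K] {B : Type*} [CommRing B] [Algebra K B]
    (b c : Module.Basis (Fin 4) K B) (hc0 : c 0 = 1) (η ζ : B) (hb : ⇑b = ![1, η, ζ, η * ζ])
    (s : Polynomial K) :
    ((Polynomial.mapRingHom (epsA η ζ)).comp (sigP b c : _ →+* Polynomial (A3 K))) (pS s) =
      Polynomial.C (s.map (algebraMap K B)) := by
  have hb0 : c 0 = b 0 := by rw [hc0, hb]; rfl
  have : (((Polynomial.mapRingHom (epsA η ζ)).comp (sigP b c : _ →+* Polynomial (A3 K))).comp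
      (pSHom : Polynomial K →+* MvPolynomial (Fin 4) K)) =
      Polynomial.C.comp (Polynomial.mapRingHom (algebraMap K B)) := by
    apply Polynomial.ringHom_ext
    · intro a
      change Polynomial.map (epsA η ζ) (sigP b c (pS (Polynomial.C a))) = _
      rw [pS_C, ← MvPolynomial.algebraMap_eq, AlgEquiv.commutes, algQ, Polynomial.map_C, epsA_k]
      simp
    · change Polynomial.map (epsA η ζ) (sigP b c (pS Polynomial.X)) = _
      rw [pS_X, sigP_X, hb0, Module.Basis.constr_basis]
      change Polynomial.map (epsA η ζ) (Polynomial.C xA) = _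
      rw [Polynomial.map_C, epsA_x]
      simp
  exact RingHom.congr_fun this s

lemma colon_iff {R : Type*} [CommRing R] (a I : Ideal R) (f : R) :
    f ∈ a.colon (I : Set R) ↔ ∀ g ∈ I, f * g ∈ a := by
  rw [Submodule.mem_colon]; rfl

theorem link_all {K : Type*} [Field K] {B : Type*} [CommRing B] [Algebra K B]
    (Φ : MvPolynomial (Fin 4) K →ₗ[K] K) (c : Module.Basis (Fin 4) K B)
    (hc0 : c 0 = 1) (φ : B →ₗ[K] K) (hnd : ∀ a, (∀ b, φ (a * b) = 0) → a = 0)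
    (hΦ : ∀ f, Φ f = φ ((piMap (K := K) c f).coeff 3)) (v : B) (hv : IsUnit v) (hφv : φ v = 0)
    (I1 : Ideal (MvPolynomial (Fin 4) K)) (hI1 : I1 = RingHom.ker (piMap (K := K) c)) :
    ∃ (I₂ : Ideal (MvPolynomial (Fin 4) K)) (a₁ a₂ a₃ : MvPolynomial (Fin 4) K),
          a₁ ∈ I1 ⊓ I₂ ∧ a₂ ∈ I1 ⊓ I₂ ∧ a₃ ∈ I1 ⊓ I₂ ∧
          RingTheory.Sequence.IsRegular (MvPolynomial (Fin 4) K) [a₁, a₂, a₃] ∧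
          (Ideal.span {a₁, a₂, a₃}).colon (I1 : Set (MvPolynomial (Fin 4) K)) = I₂ ∧
          (Ideal.span {a₁, a₂, a₃}).colon (I₂ : Set (MvPolynomial (Fin 4) K)) = I1 ∧
          annIdeal K Φ = I1 + I₂ ∧
          HasLengthThreeFreeResolution I1 ∧ HasLengthThreeFreeResolution I₂ := by
  have hfin : Module.Finite K B := Module.Finite.of_basis c
  have hnt : Nontrivial B := ⟨⟨c 0, 0, c.ne_zero 0⟩⟩
  let φ' : B →ₗ[K] K := φ ∘ₗ LinearMap.mulLeft K v
  have hφ' : ∀ x, φ' x = φ (v * x) := fun x => rfl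
  have h1' : φ' 1 = 0 := by rw [hφ', mul_one, hφv]
  have hnd' : ∀ a, (∀ b, φ' (a * b) = 0) → a = 0 := by
    intro a h
    have := hnd (v * a) (fun b => by rw [mul_assoc]; exact h b)
    exact hv.mul_right_eq_zero.mp this
  obtain ⟨η, ζ, b, α, γ, a0, a1, a2, b0, b1, b2, hb, hη, hζ, hω, e1, e2, hαγ⟩ :=
    exists_eta_zeta c φ' hnd' h1'
  have hli : LinearIndependent K ![1, η, ζ, η * ζ] := hb ▸ b.linearIndependent
  obtain ⟨p1, p2, p3, hreg, hle, hcolon, hI2, hI2', hmon, hmem⟩ :=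
    link (sigP b c).toRingEquiv (epsA (K := K) η ζ) φ' (η * ζ) v
      (eps_range e1 e2 hαγ b hb φ' h1' hη hζ hω) h1' hω (g1A α a0 a1 a2) (g2A γ b0 b1 b2)
      (eps_ker e1 e2 hαγ hli)
      (fun f hf => (mul_eq_zero.mp hf).resolve_left (g1A_ne_zero α a0 a1 a2))
      (g1_dvd_of α γ a0 a1 a2 b0 b1 b2 hαγ)
      (piMap (K := K) c : MvPolynomial (Fin 4) K →+* Polynomial B) (sigP_pi b c η ζ hb)
  have hker : RingHom.ker (piMap (K := K) c : MvPolynomial (Fin 4) K →+* Polynomial B) = I1 := hI1.symm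
  rw [hker] at hle hcolon hI2 hI2'
  have hI1m : ∀ f, f ∈ I1 ↔ piMap (K := K) c f = 0 := fun f => by rw [hI1, RingHom.mem_ker]
  set 𝔞 := Ideal.span {p1, p2, p3} with h𝔞
  have hle2 : 𝔞 ≤ 𝔞.colon (I1 : Set (MvPolynomial (Fin 4) K)) := fun f hf => by
    rw [colon_iff]
    intro g _
    exact Ideal.mul_mem_right g _ hf
  have m1 : p1 ∈ 𝔞 := Ideal.subset_span (by simp)
  have m2 : p2 ∈ 𝔞 := Ideal.subset_span (by simp)
  have m3 : p3 ∈ 𝔞 := Ideal.subset_span (by simp)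
  have hΨ := psi_pS b c hc0 η ζ hb
  have hmem' : ∀ f, f ∈ 𝔞 ↔ ((Polynomial.mapRingHom (epsA η ζ)).comp
      (sigP b c : _ →+* Polynomial (A3 K))) f %ₘ (aPol (η * ζ) v) = 0 := hmem
  refine ⟨_, p1, p2, p3, ⟨hle m1, hle2 m1⟩, ⟨hle m2, hle2 m2⟩, ⟨hle m3, hle2 m3⟩, hreg, rfl, hcolon,
    ?_, ?_, ?_⟩
  · apply le_antisymm
    · intro f hf
      rw [ann_mem Φ c hc0 φ hnd hΦ] at hf
      obtain ⟨f0, f1, f2, f3⟩ := hf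
      obtain ⟨r, hr⟩ : Polynomial.X ^ 3 ∣ piMap (K := K) c f := by
        rw [Polynomial.X_pow_dvd_iff]
        intro d hd
        interval_cases d <;> assumption
      obtain ⟨w, hw⟩ := hv.exists_right_inv
      have hr0 : (piMap (K := K) c f).coeff 3 = r.coeff 0 := by
        rw [hr, Polynomial.coeff_X_pow_mul' r 3 3]; simp
      obtain ⟨g, hg, hgr⟩ := hI2' (Polynomial.C w * (Polynomial.X * r)) (by simp) (by
        rw [Polynomial.coeff_C_mul, Polynomial.coeff_X_mul, hφ', ← mul_assoc, hw, one_mul, ← hr0, f3])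
      rw [Submodule.add_eq_sup, Submodule.mem_sup]
      refine ⟨f - g, ?_, g, hg, by ring⟩
      rw [hI1m, map_sub, sub_eq_zero, hr]
      refine Eq.trans ?_ hgr.symm
      have : Polynomial.C v * Polynomial.C w = (1 : Polynomial B) := by
        rw [← Polynomial.C_mul, hw, Polynomial.C_1]
      linear_combination (-(Polynomial.X ^ 3 * r)) * this
    · rw [Submodule.add_eq_sup, sup_le_iff]
      constructor
      · intro f hf
        rw [hI1m] at hf
        rw [ann_mem Φ c hc0 φ hnd hΦ, hf]
        simp
      · intro g hg
        obtain ⟨d, d0, d1, hd⟩ := hI2 g hg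
        have hd' : piMap (K := K) c g = Polynomial.X ^ 2 * (Polynomial.C v * d) := by
          refine Eq.trans hd ?_
          ring
        rw [ann_mem Φ c hc0 φ hnd hΦ, hd']
        refine ⟨?_, ?_, ?_, ?_⟩
        · rw [Polynomial.coeff_X_pow_mul']; simp
        · rw [Polynomial.coeff_X_pow_mul']; simp
        · rw [Polynomial.coeff_X_pow_mul']; simp [d0]
        · rw [Polynomial.coeff_X_pow_mul']; simpa [hφ'] using d1
  · refine res_of_link _ hΨ _ hmon 𝔞 hmem' I1 hle ?_
    intro s hs f hf
    rw [hI1m, map_mul, piMap_pS c hc0] at hf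
    rw [hI1m]
    exact map_cancel s hs _ hf
  · refine res_of_link _ hΨ _ hmon 𝔞 hmem' _ hle2 ?_
    intro s hs f hf
    rw [colon_iff] at hf ⊢
    intro g hg
    refine link_tf _ hΨ _ hmon 𝔞 hmem' s hs _ ?_
    rw [← mul_assoc]
    exact hf g hg
end FinalPart

/-- **Theorem 9.1.**  Assume `Φ` is a degree-3 Macaulay inverse system on
`P = k[x,y,z,w]` whose annihilator contains no nonzero linear form, `p` is
bijective, and the symmetric matrix `SM` is zero.  Then `ann Φ` has nine
minimal generators, and `ann Φ` is the sum of two linked grade-three perfect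
ideals, the first of which is generated by the six quadrics `q − x·ℓ_q`. -/
theorem annIdeal_sum_of_linked_of_smMatrix_eq_zero
    (Φ : MvPolynomial (Fin 4) k →ₗ[k] k)
    (hΦ : ∀ m : Fin 4 →₀ ℕ, (m.sum fun _ e => e) ≠ 3 → Φ (monomial m 1) = 0)
    (hlin : ∀ u ∈ homogeneousSubmodule (Fin 4) k 1, u ∈ annIdeal k Φ → u = 0)
    (hp : Function.Bijective (pMap k Φ))
    (ly2 lyz lyw lz2 lzw lw2 : MvPolynomial (Fin 4) k)
    (hly2m : ly2 ∈ homogeneousSubmodule (Fin 4) k 1)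
    (hlyzm : lyz ∈ homogeneousSubmodule (Fin 4) k 1)
    (hlywm : lyw ∈ homogeneousSubmodule (Fin 4) k 1)
    (hlz2m : lz2 ∈ homogeneousSubmodule (Fin 4) k 1)
    (hlzwm : lzw ∈ homogeneousSubmodule (Fin 4) k 1)
    (hlw2m : lw2 ∈ homogeneousSubmodule (Fin 4) k 1)
    (hly2 : ∀ v ∈ homogeneousSubmodule (Fin 4) k 1,
      Φ (X 0 * ly2 * v) = Φ (X 1 ^ 2 * v))
    (hlyz : ∀ v ∈ homogeneousSubmodule (Fin 4) k 1,
      Φ (X 0 * lyz * v) = Φ (X 1 * X 2 * v))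
    (hlyw : ∀ v ∈ homogeneousSubmodule (Fin 4) k 1,
      Φ (X 0 * lyw * v) = Φ (X 1 * X 3 * v))
    (hlz2 : ∀ v ∈ homogeneousSubmodule (Fin 4) k 1,
      Φ (X 0 * lz2 * v) = Φ (X 2 ^ 2 * v))
    (hlzw : ∀ v ∈ homogeneousSubmodule (Fin 4) k 1,
      Φ (X 0 * lzw * v) = Φ (X 2 * X 3 * v))
    (hlw2 : ∀ v ∈ homogeneousSubmodule (Fin 4) k 1,
      Φ (X 0 * lw2 * v) = Φ (X 3 ^ 2 * v))
    (hSM : smMatrix k Φ ly2 lyz lyw lz2 lzw lw2 = 0) :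
    (annIdeal k Φ : Submodule _ _).leastSpanRank = 9 ∧
      ∃ (I₁ I₂ : Ideal (MvPolynomial (Fin 4) k)) (a₁ a₂ a₃ : MvPolynomial (Fin 4) k),
        I₁ = Ideal.span {X 1 ^ 2 - X 0 * ly2, X 1 * X 2 - X 0 * lyz,
            X 1 * X 3 - X 0 * lyw, X 2 ^ 2 - X 0 * lz2,
            X 2 * X 3 - X 0 * lzw, X 3 ^ 2 - X 0 * lw2} ∧
          a₁ ∈ I₁ ⊓ I₂ ∧ a₂ ∈ I₁ ⊓ I₂ ∧ a₃ ∈ I₁ ⊓ I₂ ∧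
          RingTheory.Sequence.IsRegular (MvPolynomial (Fin 4) k) [a₁, a₂, a₃] ∧
          (Ideal.span {a₁, a₂, a₃}).colon I₁ = I₂ ∧
          (Ideal.span {a₁, a₂, a₃}).colon I₂ = I₁ ∧
          annIdeal k Φ = I₁ + I₂ ∧
          HasLengthThreeFreeResolution I₁ ∧ HasLengthThreeFreeResolution I₂ := by
  have hsq : ∀ i : Fin 4, (X i ^ 2 : MvPolynomial (Fin 4) k) = X i * X i := fun i => pow_two _
  simp only [hsq] at hly2 hlz2 hlw2 ⊢
  have hquad := quad_symm Φ hp ly2 lyz lyw lz2 lzw lw2 hly2m hlyzm hlywm hlz2m hlzwm hlw2m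
    hly2 hlyz hlyw hlz2 hlzw hlw2 hSM
  obtain ⟨B, iB, aB, c, φ, hc0, hnd, hΦ', hl⟩ := exists_frobenius Φ hp hΦ hquad
  obtain ⟨v, hv, hφv⟩ := exists_unit_ker c φ hnd
  have hX : ∀ i j l, l ∈ P1 k → (∀ v ∈ P1 k, Φ (X 0 * l * v) = Φ (X i * X j * v)) →
      piMap (K := k) c (X i * X j - X 0 * l) = 0 := by
    intro i j l hlm h
    rw [map_sub, map_mul, map_mul, hl l i j hlm h, piMap_X, piMap_X, piMap_X, hc0]
    simp only [Polynomial.C_mul, Polynomial.C_1]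
    ring
  let u : Fin 6 → MvPolynomial (Fin 4) k := ![X 1 * X 1 - X 0 * ly2, X 1 * X 2 - X 0 * lyz,
    X 1 * X 3 - X 0 * lyw, X 2 * X 2 - X 0 * lz2, X 2 * X 3 - X 0 * lzw, X 3 * X 3 - X 0 * lw2]
  have hset : (Set.range u) = {X 1 * X 1 - X 0 * ly2, X 1 * X 2 - X 0 * lyz,
    X 1 * X 3 - X 0 * lyw, X 2 * X 2 - X 0 * lz2, X 2 * X 3 - X 0 * lzw, X 3 * X 3 - X 0 * lw2} := by
    simp only [u, Matrix.range_cons, Matrix.range_empty, Set.union_empty, Set.singleton_union]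
  have hker : Ideal.span (Set.range u) = RingHom.ker (piMap (K := k) c) := by
    apply ker_pi_eq c hc0
    · rw [Ideal.span_le, hset]
      rintro x (rfl | rfl | rfl | rfl | rfl | rfl)
      · exact hX 1 1 _ hly2m hly2
      · exact hX 1 2 _ hlyzm hlyz
      · exact hX 1 3 _ hlywm hlyw
      · exact hX 2 2 _ hlz2m hlz2
      · exact hX 2 3 _ hlzwm hlzw
      · exact hX 3 3 _ hlw2m hlw2
    · have hm : ∀ i : Fin 6, u i ∈ Ideal.span (Set.range u) := fun i => Ideal.subset_span ⟨i, rfl⟩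
      have hsw : ∀ i j : Fin 4, (∃ l ∈ P1 k, X i * X j - X 0 * l ∈ Ideal.span (Set.range u)) →
          ∃ l ∈ P1 k, X j * X i - X 0 * l ∈ Ideal.span (Set.range u) := by
        rintro i j ⟨l, h1, h2⟩
        exact ⟨l, h1, by rw [mul_comm (X j)]; exact h2⟩
      have h0 : ∀ j : Fin 4, ∃ l ∈ P1 k, X 0 * X j - X 0 * l ∈ Ideal.span (Set.range u) := fun j =>
        ⟨X j, isHomogeneous_X k j, by simp⟩
      have h11 : ∃ l ∈ P1 k, X 1 * X 1 - X 0 * l ∈ Ideal.span (Set.range u) := ⟨_, hly2m, hm 0⟩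
      have h12 : ∃ l ∈ P1 k, X 1 * X 2 - X 0 * l ∈ Ideal.span (Set.range u) := ⟨_, hlyzm, hm 1⟩
      have h13 : ∃ l ∈ P1 k, X 1 * X 3 - X 0 * l ∈ Ideal.span (Set.range u) := ⟨_, hlywm, hm 2⟩
      have h22 : ∃ l ∈ P1 k, X 2 * X 2 - X 0 * l ∈ Ideal.span (Set.range u) := ⟨_, hlz2m, hm 3⟩
      have h23 : ∃ l ∈ P1 k, X 2 * X 3 - X 0 * l ∈ Ideal.span (Set.range u) := ⟨_, hlzwm, hm 4⟩
      have h33 : ∃ l ∈ P1 k, X 3 * X 3 - X 0 * l ∈ Ideal.span (Set.range u) := ⟨_, hlw2m, hm 5⟩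
      intro i j
      fin_cases i <;> fin_cases j
      · exact h0 0
      · exact h0 1
      · exact h0 2
      · exact h0 3
      · exact hsw _ _ (h0 1)
      · exact h11
      · exact h12
      · exact h13
      · exact hsw _ _ (h0 2)
      · exact hsw _ _ h12
      · exact h22
      · exact h23
      · exact hsw _ _ (h0 3)
      · exact hsw _ _ h13
      · exact hsw _ _ h23
      · exact h33
  refine ⟨?_, ?_⟩
  · refine nine_gens Φ c hc0 φ hnd hΦ' v hv hφv u ![ly2, lyz, lyw, lz2, lzw, lw2] ?_ hker
    intro i
    fin_cases i <;> rfl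
  · obtain ⟨I₂, a₁, a₂, a₃, h⟩ := link_all Φ c hc0 φ hnd hΦ' v hv hφv _ hker
    rw [hset] at h
    exact ⟨_, I₂, a₁, a₂, a₃, rfl, h⟩

end
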